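/- arXiv:1807.04785 — 6 statements merged into one kernel-verified Lean document; each statement's English description precedes it below -/
import Mathlib

section
/- There exists an absolute constant C > 0 such that for all even integers n ≥ 2, all even integers m, and every group G ≅ H_{n,m} with generators x, y as above, the number of (n+1)-element subsets S of G with 1 ∉ ∏_n(S), divided by the total number C(2n, n+1) of (n+1)-element subsets of G, is less than C·√(n/2^n). -/
/-- `prodTuples t S` is the set of all `t`-fold products of distinct elements of `S`. -/
def prodTuples {G : Type*} [Group G] (t : ℕ) (S : Set G) : Set G :=
  {g : G | ∃ l : List G, l.Nodup ∧ l.length = t ∧ (∀ a ∈ l, a ∈ S) ∧ l.prod = g}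


open scoped Pointwise in
theorem aux_subsum (N : ℕ) : ∀ {Γ : Type} [AddCommGroup Γ] [Finite Γ] {ι : Type} [DecidableEq ι]
    (s : Finset ι) (g : ι → Γ), Nat.card Γ ≤ N →
    (∀ K : AddSubgroup Γ, K ≠ ⊤ → K.index ≤ {i | i ∈ s ∧ g i ∉ K}.ncard + 1) →
    ∀ τ : Γ, ∃ I ⊆ s, ∑ i ∈ I, g i = τ := by
  classical
  induction N with
  | zero =>
    intro Γ _ _ ι _ s g hN
    have := Nat.card_pos (α := Γ)
    omega
  | succ N ih =>
    intro Γ _ _ ι _ s g hN H τ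
    have := Fintype.ofFinite Γ
    let P : Finset ι → Finset Γ := fun U => U.powerset.image (fun I => ∑ i ∈ I, g i)
    have hP : ∀ U z, z ∈ P U ↔ ∃ I ⊆ U, ∑ i ∈ I, g i = z := by
      intro U z; simp [P]
    obtain ⟨U, hU, hmax⟩ := Finset.exists_max_image
      (s.powerset.filter (fun U => U.card + 1 ≤ (P U).card)) Finset.card ⟨∅, by simp [P]⟩
    simp only [Finset.mem_filter, Finset.mem_powerset] at hU hmax
    have hst : ∀ i ∈ s, i ∉ U → ∀ z ∈ P U, g i + z ∈ P U := by
      intro i his hiU z hz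
      by_contra hc
      have hsub : insert (g i + z) (P U) ⊆ P (insert i U) := by
        intro w hw
        rw [Finset.mem_insert] at hw
        rw [hP]
        rcases hw with rfl | hw
        · obtain ⟨I, hI, rfl⟩ := (hP _ _).1 hz
          refine ⟨insert i I, Finset.insert_subset_insert _ hI, ?_⟩
          rw [Finset.sum_insert (fun h => hiU (hI h))]
        · obtain ⟨I, hI, rfl⟩ := (hP _ _).1 hw
          exact ⟨I, hI.trans (Finset.subset_insert _ _), rfl⟩
      have h1 := Finset.card_le_card hsub
      rw [Finset.card_insert_of_notMem hc] at h1
      have h2 := hmax (insert i U) ⟨Finset.insert_subset his hU.1, by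
        rw [Finset.card_insert_of_notMem hiU]; omega⟩
      rw [Finset.card_insert_of_notMem hiU] at h2
      omega
    suffices hh : τ ∈ P U by
      obtain ⟨I, hI, h⟩ := (hP _ _).1 hh
      exact ⟨I, hI.trans hU.1, h⟩
    let K : AddSubgroup Γ := AddAction.stabilizer Γ (P U)
    have hK : ∀ k : Γ, k ∈ K ↔ ∀ z ∈ P U, k + z ∈ P U := by
      intro k
      rw [AddAction.mem_stabilizer_finset']
      simp only [vadd_eq_add]
      
    have hgK : ∀ i ∈ s, i ∉ U → g i ∈ K := fun i h1 h2 => (hK _).2 (hst i h1 h2)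
    have h0 : (0 : Γ) ∈ P U := (hP _ _).2 ⟨∅, by simp, by simp⟩
    by_cases hT : K = ⊤
    · have : τ ∈ K := by rw [hT]; trivial
      simpa using (hK _).1 this 0 h0
    by_cases hB : K = ⊥
    · have h1 := H ⊥ (hB ▸ hT)
      have h2 : {i | i ∈ s ∧ g i ∉ (⊥ : AddSubgroup Γ)}.ncard ≤ U.card := by
        rw [← Set.ncard_coe_finset]
        apply Set.ncard_le_ncard _ (Finset.finite_toSet _)
        intro i hi
        by_contra hc
        exact hi.2 (hB ▸ hgK i hi.1 hc)
      rw [AddSubgroup.index_bot, Nat.card_eq_fintype_card] at h1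
      have : P U = Finset.univ := by
        rw [← Finset.card_eq_iff_eq_univ]
        have := Finset.card_le_univ (P U)
        omega
      rw [this]; simp
    · have hc : Nat.card (Γ ⧸ K) ≤ N := by
        have h1 := K.card_mul_index
        have h2 : 1 < Nat.card K := by
          rw [AddSubgroup.one_lt_card_iff_ne_bot]; exact hB
        have h3 : 0 < K.index := Nat.pos_of_ne_zero K.index_ne_zero_of_finite
        change K.index ≤ N
        nlinarith
      obtain ⟨I, hI, hIs⟩ := ih s (fun i => (QuotientAddGroup.mk' K) (g i)) hc (by
        intro K' hK'
        have hs := QuotientAddGroup.mk'_surjective K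
        have h1 := H (K'.comap (QuotientAddGroup.mk' K)) (by
          intro h
          apply hK'
          rw [← AddSubgroup.comap_top (QuotientAddGroup.mk' K)] at h
          exact AddSubgroup.comap_injective hs h)
        rw [AddSubgroup.index_comap_of_surjective _ hs] at h1
        exact h1) (QuotientAddGroup.mk' K τ)
      rw [← map_sum] at hIs
      have h3 : -(∑ i ∈ I, g i) + τ ∈ K := QuotientAddGroup.eq.1 hIs
      have h4 : ∑ i ∈ I.filter (· ∉ U), g i ∈ K := by
        apply AddSubgroup.sum_mem
        intro i hi
        rw [Finset.mem_filter] at hi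
        exact hgK i (hI hi.1) hi.2
      have h5 := Finset.sum_filter_add_sum_filter_not I (· ∈ U) g
      have h6 : ∑ i ∈ I.filter (· ∈ U), g i ∈ P U :=
        (hP _ _).2 ⟨_, fun i hi => (Finset.mem_filter.1 hi).2, rfl⟩
      have h7 := (hK _).1 (K.add_mem h3 h4) _ h6
      rw [← h5] at h7
      convert h7 using 1
      abel

theorem aux_central (n : ℕ) (hn : 1 ≤ n) : 16 ^ n ≤ 4 * n * (Nat.centralBinom n) ^ 2 := by
  induction n, hn using Nat.le_induction with
  | base => simp [Nat.centralBinom]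
  | succ n hn ih =>
    have h := Nat.succ_mul_centralBinom_succ n
    have h2 : (n+1) * 16^(n+1) ≤ (n+1) * (4 * (n+1) * (Nat.centralBinom (n+1))^2) := by
      calc (n+1) * 16^(n+1) = 16 * (n+1) * 16^n := by ring
        _ ≤ 16 * (n+1) * (4 * n * (Nat.centralBinom n) ^ 2) := Nat.mul_le_mul_left _ ih
        _ = 16 * (4 * n * (n+1)) * (Nat.centralBinom n) ^ 2 := by ring
        _ ≤ 16 * ((2*n+1)^2) * (Nat.centralBinom n) ^ 2 := by gcongr; nlinarith
        _ = 4 * (2 * (2*n+1) * Nat.centralBinom n)^2 := by ring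
        _ = _ := by rw [← h]; ring
    exact Nat.le_of_mul_le_mul_left h2 (by omega)

theorem aux_choose (n : ℕ) (hn : 1 ≤ n) :
    (4:ℝ) ^ n ≤ 4 * Real.sqrt n * (Nat.choose (2*n) (n+1)) := by
  have h1 := aux_central n hn
  have h2 : Nat.centralBinom n ≤ 2 * Nat.choose (2*n) (n+1) := by
    have h := Nat.choose_succ_right_eq (2*n) n
    rw [← Nat.centralBinom_eq_two_mul_choose, show 2 * n - n = n by omega] at h
    nlinarith
  have h3 : 16 ^ n ≤ 16 * n * (Nat.choose (2*n) (n+1)) ^ 2 := by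
    calc _ ≤ _ := h1
      _ ≤ 4 * n * (2 * Nat.choose (2*n) (n+1))^2 := by gcongr
      _ = _ := by ring
  have h4 : ((16:ℝ)) ^ n ≤ 16 * n * (Nat.choose (2*n) (n+1)) ^ 2 := by exact_mod_cast h3
  refine (sq_le_sq₀ (by positivity) (by positivity)).1 ?_
  rw [mul_pow, mul_pow, Real.sq_sqrt (by positivity), ← pow_mul, mul_comm n 2, pow_mul]
  norm_num
  exact h4

theorem aux_pow4 (h : ℕ) : h ^ 4 ≤ 32 * 2 ^ h := by
  rcases Nat.lt_or_ge h 6 with hh | hh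
  · interval_cases h <;> norm_num
  · induction h, hh using Nat.le_induction with
    | base => norm_num
    | succ n hn ih =>
      have : (n+1)^4 ≤ 2 * n^4 := by
        obtain ⟨k, rfl⟩ := Nat.exists_eq_add_of_le hn
        ring_nf
        nlinarith [sq_nonneg k, Nat.zero_le (k^3), Nat.zero_le (k^4)]
      rw [pow_succ 2 n]; omega

theorem aux_list {G : Type} [DecidableEq G] (L : List G) (T : Finset G) (h1 : ∀ a ∈ T, a ∈ L)
    (h2 : L.length = T.card) : L.Nodup ∧ ∀ a ∈ L, a ∈ T := by
  have h3 : T ⊆ L.toFinset := fun a ha => by simpa using h1 a ha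
  have h4 := L.toFinset_card_le
  have h5 : T = L.toFinset := Finset.eq_of_subset_of_card_le h3 (by omega)
  constructor
  · rw [← Multiset.coe_nodup, ← Multiset.toFinset_card_eq_card_iff_nodup]
    change L.toFinset.card = L.length
    rw [← h5, h2]
  · intro a ha; rw [h5]; simpa using ha

/-- few: -/
theorem aux_few {G : Type} [Fintype G] [DecidableEq G] (E : Finset G) (n : ℕ) (hn : 1 ≤ n) (hE : E.card = n)
    (hG : Fintype.card G = 2 * n) :
    (Finset.univ.filter (fun S : Finset G => (S ∩ E).card ≤ 4)).card ≤ 5 * n ^ 4 * 2 ^ n := by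
  have h1 : (Finset.univ.filter (fun S : Finset G => (S ∩ E).card ≤ 4)).card ≤
      (((Finset.range 5).biUnion (fun i => E.powersetCard i)) ×ˢ Eᶜ.powerset).card := by
    apply Finset.card_le_card_of_injOn (fun S => (S ∩ E, S ∩ Eᶜ))
    · intro S hS
      simp only [Finset.coe_filter, Finset.mem_univ, true_and, Set.mem_ofPred_eq] at hS
      simp [Finset.mem_powersetCard]
      omega
    · intro S _ T _ h
      simp only [Prod.mk.injEq] at h
      ext z
      have a1 := congrArg (z ∈ ·) h.1
      have a2 := congrArg (z ∈ ·) h.2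
      simp at a1 a2
      tauto
  refine h1.trans ?_
  rw [Finset.card_product, Finset.card_powerset, Finset.card_compl, hE, hG, show 2 * n - n = n by omega]
  apply Nat.mul_le_mul_right
  refine Finset.card_biUnion_le.trans ?_
  calc _ ≤ ∑ i ∈ Finset.range 5, n ^ 4 := by
        apply Finset.sum_le_sum
        intro i hi
        rw [Finset.card_powersetCard, hE]
        refine (Nat.choose_le_pow n i).trans ?_
        exact Nat.pow_le_pow_right hn (by simp at hi; omega)
    _ = _ := by simp

theorem aux_avoid {G : Type} [Fintype G] [DecidableEq G] (X : Finset G) (h : ℕ) (hX : X.card = h)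
    (hG : Fintype.card G = 4 * h) :
    (Finset.univ.filter (fun S : Finset G => ∀ z ∈ X, z ∉ S)).card = 8 ^ h := by
  have : Finset.univ.filter (fun S : Finset G => ∀ z ∈ X, z ∉ S) = Xᶜ.powerset := by
    ext S
    simp only [Finset.mem_filter, Finset.mem_univ, true_and, Finset.mem_powerset, Finset.subset_iff, Finset.mem_compl]
    constructor
    · intro h z hz hx; exact h z hx hz
    · intro h z hz hx; exact h hx hz
  rw [this, Finset.card_powerset, Finset.card_compl, hX, hG, show 4 * h - h = 3 * h by omega, pow_mul]
  norm_num

theorem aux_one_not_mem (h : ℕ) [NeZero h] (K : AddSubgroup (ZMod h)) (hK : K ≠ ⊤) : (1 : ZMod h) ∉ K := by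
  intro h1
  apply hK
  rw [eq_top_iff]
  intro z _
  have : z = z.val • (1 : ZMod h) := by simp
  rw [this]
  exact K.nsmul_mem h1 _

theorem aux_comap_card (h : ℕ) [NeZero h] (K : AddSubgroup (ZMod h)) (hd : h ∣ 2 * h) :
    {z : ZMod (2 * h) | ZMod.castHom hd (ZMod h) z ∈ K}.ncard = 2 * Nat.card K := by
  let f : ZMod (2 * h) →+ ZMod h := (ZMod.castHom hd (ZMod h)).toAddMonoidHom
  have hf : Function.Surjective f := ZMod.castHom_surjective hd
  have h1 := AddSubgroup.index_comap_of_surjective K hf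
  have h2 := (K.comap f).card_mul_index
  have h3 := K.card_mul_index
  rw [h1, Nat.card_zmod] at h2
  rw [Nat.card_zmod] at h3
  have h4 : {z : ZMod (2 * h) | ZMod.castHom hd (ZMod h) z ∈ K}.ncard = Nat.card (K.comap f) := rfl
  rw [h4]
  have h5 : 0 < K.index := by
    rcases Nat.eq_zero_or_pos K.index with h0 | h0
    · rw [h0] at h3; exact absurd h3.symm (NeZero.ne h)
    · exact h0
  apply Nat.eq_of_mul_eq_mul_right h5
  rw [h2, mul_assoc, h3]

theorem aux_odd_not_mem (h : ℕ) [NeZero h] (K : AddSubgroup (ZMod h)) (hK : K.index = 2)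
    (hd : h ∣ 2 * h) (hd2 : 2 ∣ 2 * h) (a : ZMod (2 * h)) (ha : ZMod.castHom hd2 (ZMod 2) a ≠ 0) :
    ZMod.castHom hd (ZMod h) a ∉ K := by
  intro hc
  have hK1 : K ≠ ⊤ := by rintro rfl; simp at hK
  apply aux_one_not_mem h K hK1
  obtain ⟨k, rfl⟩ := ZMod.intCast_surjective a
  rw [map_intCast] at ha hc
  have : Odd k := by
    rw [← Int.not_even_iff_odd, even_iff_two_dvd]
    intro hh
    exact ha ((ZMod.intCast_zmod_eq_zero_iff_dvd k 2).2 hh)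
  obtain ⟨t, rfl⟩ := this
  have h2 := AddSubgroup.two_smul_mem_of_index_two hK (t : ZMod h)
  have := K.sub_mem hc h2
  convert this using 1
  push_cast
  simp

theorem aux_cover (h : ℕ) [NeZero h] (hd : h ∣ 2 * h) (hd2 : 2 ∣ 2 * h) (A D : Finset (ZMod (2 * h)))
    (δ : ZMod (2 * h)) (hc : h ≤ A.card + D.card) (hδ : ZMod.castHom hd (ZMod h) δ ≠ 0)
    (h2 : h ≠ A.card ∨ 0 < D.card ∨ (∃ a ∈ A, ZMod.castHom hd2 (ZMod 2) a ≠ 0) ∨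
      ZMod.castHom hd2 (ZMod 2) δ ≠ 0) (τ : ZMod h) :
    ∃ I ⊆ A, ∃ ε : Prop, ∃ _ : Decidable ε, ∃ J ⊆ D,
      ∑ a ∈ I, ZMod.castHom hd (ZMod h) a + (if ε then ZMod.castHom hd (ZMod h) δ else 0) + J.card = τ := by
  classical
  let f := ZMod.castHom hd (ZMod h)
  let g : ZMod (2 * h) ⊕ (ZMod (2 * h) ⊕ Unit) → ZMod h :=
    Sum.elim f (Sum.elim (fun _ => 1) (fun _ => f δ))
  obtain ⟨I, hI, hs⟩ := aux_subsum (Nat.card (ZMod h)) (A.disjSum (D.disjSum {()})) g le_rfl (by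
    intro K hK
    have h1 : {i | i ∈ A.disjSum (D.disjSum {()}) ∧ g i ∉ K} =
        (((A.filter (fun a => f a ∉ K)).disjSum (D.disjSum (({()} : Finset Unit).filter (fun _ => f δ ∉ K))) : Finset _) : Set _) := by
      ext i
      rcases i with a | d | u
      · simp [g]
      · simp [g, aux_one_not_mem h K hK]
      · by_cases hh : f δ ∈ K <;> simp [g, hh]
    rw [h1, Set.ncard_coe_finset, Finset.card_disjSum, Finset.card_disjSum]
    have h3 : A.card ≤ (A.filter (fun a => f a ∉ K)).card + 2 * Nat.card K := by
      rw [← Finset.card_filter_add_card_filter_not (s := A) (fun a => f a ∉ K)]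
      apply Nat.add_le_add_left
      rw [← aux_comap_card h K hd, ← Set.ncard_coe_finset]
      apply Set.ncard_le_ncard _ (Set.toFinite _)
      intro a ha
      exact not_not.1 (Finset.mem_filter.1 ha).2
    have h4 := K.card_mul_index
    rw [Nat.card_zmod] at h4
    have hK1 : K.index ≠ 1 := by simpa using hK
    have hK0 : K.index ≠ 0 := by
      intro h0; rw [h0] at h4; exact NeZero.ne h h4.symm
    have hw0 : Nat.card K ≠ 0 := by
      intro h0; rw [h0] at h4; apply NeZero.ne h; rw [← h4]; ring
    generalize hq : K.index = q at *
    generalize hw : Nat.card K = w at *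
    have hsing : f δ ∉ K → (({()} : Finset Unit).filter (fun _ => f δ ∉ K)).card = 1 := by
      intro hh; simp [hh]
    rcases Nat.lt_or_ge q 3 with hq3 | hq3
    · have hq2 : q = 2 := by omega
      subst hq2
      rcases h2 with h2 | h2 | ⟨a, ha, h2⟩ | h2
      · omega
      · omega
      · have : 0 < (A.filter (fun a => f a ∉ K)).card := by
          apply Finset.card_pos.2
          exact ⟨a, Finset.mem_filter.2 ⟨ha, aux_odd_not_mem h K hq hd hd2 a h2⟩⟩
        omega
      · have := hsing (aux_odd_not_mem h K hq hd hd2 δ h2)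
        omega
    · rcases Nat.lt_or_ge w 2 with hw2 | hw2
      · have hw1 : w = 1 := by omega
        subst hw1
        have : K = ⊥ := AddSubgroup.eq_bot_of_card_eq K hw
        have := hsing (by rw [this, AddSubgroup.mem_bot]; exact hδ)
        omega
      · have : q + 2 * w ≤ w * q + 1 := by
          obtain ⟨q', rfl⟩ := Nat.exists_eq_add_of_le hq3
          obtain ⟨w', rfl⟩ := Nat.exists_eq_add_of_le hw2
          nlinarith
        omega) τ
  refine ⟨I.toLeft, (Finset.subset_disjSum.1 hI).1, () ∈ I.toRight.toRight, inferInstance, I.toRight.toLeft,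
    (Finset.subset_disjSum.1 (Finset.subset_disjSum.1 hI).2).1, ?_⟩
  rw [← hs]
  conv_rhs => rw [← Finset.toLeft_disjSum_toRight (u := I), ← Finset.toLeft_disjSum_toRight (u := I.toRight)]
  rw [Finset.sum_disjSum, Finset.sum_disjSum]
  have : ∑ x ∈ I.toRight.toRight, g (Sum.inr (Sum.inr x)) = if () ∈ I.toRight.toRight then f δ else 0 := by
    split_ifs with hh
    · have : I.toRight.toRight = {()} := by ext u; simpa using hh
      rw [this]; simp [g]
    · have : I.toRight.toRight = ∅ := by ext u; simpa using hh
      rw [this]; simp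
  rw [this]
  simp only [g, Sum.elim_inl, Sum.elim_inr, Finset.sum_const, nsmul_eq_mul, mul_one]
  simp only [f]
  ring

theorem aux_cells (h : ℕ) [NeZero h] (hd2 : 2 ∣ 2 * h) (B : Finset (ZMod (2 * h))) (c : ℕ) (hc : c + h ≤ B.card) :
    ∃ D ⊆ B, D.card = c ∧ (∀ d ∈ D, ZMod.castHom hd2 (ZMod 2) d = 0 ∧ d + 1 ∈ B) := by
  classical
  let π := ZMod.castHom hd2 (ZMod 2)
  let E := B.filter (fun d => π d = 0)
  let O := (B.filter (fun d => ¬ π d = 0)).image (fun d => d - 1)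
  have h01 : ∀ z : ZMod 2, z ≠ 0 → z = 1 := by decide
  have hO : O.card = (B.filter (fun d => ¬ π d = 0)).card :=
    Finset.card_image_of_injective _ sub_left_injective
  have h1 : E.card + O.card = B.card := by
    rw [hO]; exact Finset.card_filter_add_card_filter_not _
  have h2 : (E ∪ O).card ≤ h := by
    have h3 : ((E ∪ O) ∪ (E ∪ O).image (fun d => d + 1)).card ≤ 2 * h := by
      have := Finset.card_le_univ ((E ∪ O) ∪ (E ∪ O).image (fun d => d + 1))
      rwa [ZMod.card] at this
    have h0 : ∀ d ∈ E ∪ O, π d = 0 := by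
      intro d hd
      rcases Finset.mem_union.1 hd with hd | hd
      · exact (Finset.mem_filter.1 hd).2
      · obtain ⟨b, hb, rfl⟩ := Finset.mem_image.1 hd
        rw [map_sub, map_one, h01 _ (Finset.mem_filter.1 hb).2]; rfl
    rw [Finset.card_union_of_disjoint, Finset.card_image_of_injective _ (add_left_injective _)] at h3
    · omega
    · rw [Finset.disjoint_left]
      intro a ha hb
      obtain ⟨b, hb', rfl⟩ := Finset.mem_image.1 hb
      have := h0 _ ha
      rw [map_add, h0 _ hb', map_one] at this
      exact absurd this (by decide)
  have h3 := Finset.card_union_add_card_inter E O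
  obtain ⟨D, hD, hDc⟩ := Finset.exists_subset_card_eq (s := E ∩ O) (n := c) (by omega)
  refine ⟨D, fun d hd => ?_, hDc, fun d hd => ?_⟩
  · exact (Finset.mem_filter.1 (Finset.mem_inter.1 (hD hd)).1).1
  · have := Finset.mem_inter.1 (hD hd)
    refine ⟨(Finset.mem_filter.1 this.1).2, ?_⟩
    obtain ⟨b, hb, hbb⟩ := Finset.mem_image.1 this.2
    rw [← hbb]; simpa using (Finset.mem_filter.1 hb).1

theorem aux_pair (h : ℕ) [NeZero h] (hd : h ∣ 2 * h) (W : Finset (ZMod (2 * h))) (hW : 3 ≤ W.card) :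
    ∃ u ∈ W, ∃ v ∈ W, ZMod.castHom hd (ZMod h) (v - u) ≠ 0 := by
  classical
  by_contra! hcon
  obtain ⟨u, hu⟩ := Finset.card_pos.1 (show 0 < W.card by omega)
  have h1 := aux_comap_card h ⊥ hd
  have h2 : (W.image (fun v => v - u)).card = W.card := Finset.card_image_of_injective _ sub_left_injective
  have h3 : (W.image (fun v => v - u)).card ≤ 2 := by
    rw [← Set.ncard_coe_finset]
    have h5 : 2 * Nat.card (⊥ : AddSubgroup (ZMod h)) = 2 := by simp
    refine le_trans ?_ (h1.trans h5).le
    apply Set.ncard_le_ncard _ (Set.toFinite _)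
    intro z hz
    obtain ⟨v, hv, rfl⟩ := Finset.mem_image.1 hz
    exact AddSubgroup.mem_bot.2 (hcon u hu v hv)
  omega

structure AuxModel (h : ℕ) {G : Type} [Group G] (e Y : ZMod (2 * h) → G) (M : ZMod (2 * h))
    (hd2 : 2 ∣ 2 * h) : Prop where
  e0 : e 0 = 1
  ee : ∀ i j, e i * e j = e (i + j)
  eY : ∀ i j, e i * Y j = Y (i + j)
  Ye : ∀ i j, Y i * e j = Y (i - j)
  YY : ∀ i j, Y i * Y j = e (i - j + M)
  einj : Function.Injective e
  Yinj : Function.Injective Y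
  disj : ∀ i j, e i ≠ Y j
  hM : ZMod.castHom hd2 (ZMod 2) M = 0

theorem aux_listY {h : ℕ} {G : Type} [Group G] {e Y : ZMod (2 * h) → G} {M : ZMod (2 * h)}
    {hd2 : 2 ∣ 2 * h} (H : AuxModel h e Y M hd2) (L : List (ZMod (2 * h))) :
    ∃ ρ, ZMod.castHom hd2 (ZMod 2) ρ = (L.map (ZMod.castHom hd2 (ZMod 2))).sum ∧
      (Even L.length → (L.map Y).prod = e ρ) ∧ (¬ Even L.length → (L.map Y).prod = Y ρ) := by
  induction L with
  | nil => exact ⟨0, by simp, by simp [H.e0], by simp⟩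
  | cons a L ih =>
    obtain ⟨ρ, h1, h2, h3⟩ := ih
    have hs : ∀ z : ZMod 2, -z = z := by decide
    by_cases hL : Even L.length
    · refine ⟨a - ρ, ?_, ?_, ?_⟩
      · rw [map_sub, h1, List.map_cons, List.sum_cons, sub_eq_add_neg, hs]
      · intro hh; rw [List.length_cons] at hh; grind
      · intro _
        rw [List.map_cons, List.prod_cons, h2 hL, H.Ye]
    · refine ⟨a - ρ + M, ?_, ?_, ?_⟩
      · rw [map_add, H.hM, map_sub, h1, List.map_cons, List.sum_cons, sub_eq_add_neg, hs, add_zero]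
      · intro _
        rw [List.map_cons, List.prod_cons, h3 hL, H.YY]
      · intro hh; rw [List.length_cons] at hh; grind

theorem aux_liste {h : ℕ} {G : Type} [Group G] {e Y : ZMod (2 * h) → G} {M : ZMod (2 * h)}
    {hd2 : 2 ∣ 2 * h} (H : AuxModel h e Y M hd2) {α : Type} (F : α → List G) (s : α → ZMod (2 * h))
    (hF : ∀ a, (F a).prod = e (s a)) (L : List α) : (L.flatMap F).prod = e (L.map s).sum := by
  induction L with
  | nil => simp [H.e0]
  | cons a L ih => simp [hF, ih, H.ee]

theorem aux_liste' {h : ℕ} {G : Type} [Group G] {e Y : ZMod (2 * h) → G} {M : ZMod (2 * h)}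
    {hd2 : 2 ∣ 2 * h} (H : AuxModel h e Y M hd2) (L : List (ZMod (2 * h))) : (L.map e).prod = e L.sum := by
  induction L with
  | nil => simp [H.e0]
  | cons a L ih => simp [ih, H.ee]

theorem aux_half (h : ℕ) (hd2 : 2 ∣ 2 * h) (z : ZMod (2 * h)) (hz : ZMod.castHom hd2 (ZMod 2) z = 0) :
    ∃ τ, z = 2 * τ := by
  obtain ⟨k, rfl⟩ := ZMod.intCast_surjective z
  rw [map_intCast, ZMod.intCast_zmod_eq_zero_iff_dvd] at hz
  obtain ⟨t, rfl⟩ := hz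
  exact ⟨t, by push_cast; rfl⟩

theorem aux_dbl (h : ℕ) (hd : h ∣ 2 * h) (z : ZMod (2 * h)) (hz : ZMod.castHom hd (ZMod h) z = 0) :
    2 * z = 0 := by
  obtain ⟨k, rfl⟩ := ZMod.intCast_surjective z
  rw [map_intCast, ZMod.intCast_zmod_eq_zero_iff_dvd] at hz
  obtain ⟨t, rfl⟩ := hz
  have : (2 : ZMod (2 * h)) * ((h * t : ℤ) : ZMod (2 * h)) = ((2 * h : ℕ) : ZMod (2 * h)) * t := by
    push_cast; ring
  rw [this, ZMod.natCast_self, zero_mul]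

theorem aux_construct {h : ℕ} [NeZero h] {G : Type} [Group G] {e Y : ZMod (2 * h) → G} {M : ZMod (2 * h)}
    {hd2 : 2 ∣ 2 * h} (H : AuxModel h e Y M hd2) (hd : h ∣ 2 * h) (A B D : Finset (ZMod (2 * h)))
    (u v : ZMod (2 * h)) (hDB : D ⊆ B) (hD1 : ∀ d ∈ D, ZMod.castHom hd2 (ZMod 2) d = 0 ∧ d + 1 ∈ B)
    (hu : u ∈ B) (hv : v ∈ B) (huD : u ∉ D ∪ D.image (· + 1)) (hvD : v ∉ D ∪ D.image (· + 1))
    (hc : A.card + B.card = 2 * h) (hBe : Even B.card)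
    (hpar : ∑ a ∈ A, ZMod.castHom hd2 (ZMod 2) a + ∑ a ∈ B, ZMod.castHom hd2 (ZMod 2) a = 0)
    (hcov : h ≤ A.card + D.card) (hδ : ZMod.castHom hd (ZMod h) (v - u) ≠ 0)
    (h2 : h ≠ A.card ∨ 0 < D.card ∨ (∃ a ∈ A, ZMod.castHom hd2 (ZMod 2) a ≠ 0) ∨
      ZMod.castHom hd2 (ZMod 2) (v - u) ≠ 0) :
    ∃ L : List G, L.Nodup ∧ L.length = 2 * h ∧
      (∀ z ∈ L, (∃ a ∈ A, e a = z) ∨ (∃ b ∈ B, Y b = z)) ∧ L.prod = 1 := by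
  classical
  let π := ZMod.castHom hd2 (ZMod 2)
  have huv : u ≠ v := by rintro rfl; simp at hδ
  let R := B \ ((D ∪ D.image (· + 1)) ∪ {u, v})
  have hsub : (D ∪ D.image (· + 1)) ∪ {u, v} ⊆ B := by
    intro z hz
    simp only [Finset.mem_union, Finset.mem_image, Finset.mem_insert, Finset.mem_singleton] at hz
    rcases hz with (hz | ⟨d, hd, rfl⟩) | rfl | rfl
    · exact hDB hz
    · exact (hD1 d hd).2
    · exact hu
    · exact hv
  have hdj1 : Disjoint D (D.image (· + 1)) := by
    rw [Finset.disjoint_left]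
    intro a ha hb
    obtain ⟨b, hb', rfl⟩ := Finset.mem_image.1 hb
    have := (hD1 _ ha).1
    rw [map_add, (hD1 _ hb').1, map_one] at this
    exact absurd this (by decide)
  have hdj2 : Disjoint (D ∪ D.image (· + 1)) {u, v} := by
    rw [Finset.disjoint_right]
    intro a ha
    rcases Finset.mem_insert.1 ha with rfl | ha
    · exact huD
    · rw [Finset.mem_singleton.1 ha]; exact hvD
  have hinj : Function.Injective (fun x : ZMod (2 * h) => x + 1) := add_left_injective _
  have hRc : R.card + 2 * D.card + 2 = B.card := by
    have := Finset.card_sdiff_add_card_eq_card hsub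
    rw [Finset.card_union_of_disjoint hdj2, Finset.card_union_of_disjoint hdj1,
      Finset.card_image_of_injective _ hinj, Finset.card_pair huv] at this
    change R.card + _ = _ at this
    omega
  have hRs : ∑ b ∈ B, π b = ∑ b ∈ R, π b + D.card + π u + π v := by
    rw [← Finset.sum_sdiff hsub, Finset.sum_union hdj2, Finset.sum_union hdj1, Finset.sum_pair huv,
      Finset.sum_image (fun _ _ _ _ hh => hinj hh)]
    have h1 : ∑ x ∈ D, π x = 0 := Finset.sum_eq_zero (fun d hd => (hD1 d hd).1)
    have h3 : ∑ x ∈ D, π (x + 1) = D.card := by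
      rw [Finset.card_eq_sum_ones, Nat.cast_sum]
      apply Finset.sum_congr rfl
      intro d hd
      have := (hD1 d hd).1
      rw [map_add, this, map_one]; simp
    rw [h1, h3]
    ring
  obtain ⟨ρ, hρ, hρ2, -⟩ := aux_listY H R.toList
  have hRe : Even R.toList.length := by
    rw [Finset.length_toList]; grind
  replace hρ2 := hρ2 hRe
  rw [Finset.sum_map_toList] at hρ
  have hs : ∀ z : ZMod 2, -z = z := by decide
  obtain ⟨τ, hτ⟩ := aux_half h hd2 (∑ a ∈ A, a + (v - u) + M + D.card * (1 + M) + ρ) (by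
    rw [map_add, map_add, map_add, map_add, map_sub, map_sum, map_mul, map_add, H.hM, hρ, map_natCast, map_one]
    refine Eq.trans ?_ hpar
    change _ = _ + ∑ b ∈ B, π b
    rw [hRs, sub_eq_add_neg, hs]
    simp only [π]
    ring)
  obtain ⟨I, hI, ε, hε, J, hJ, hIJ⟩ := aux_cover h hd hd2 A D (v - u) hcov hδ h2 (ZMod.castHom hd (ZMod h) τ)
  have hσ : 2 * (∑ a ∈ I, a + (if ε then v - u else 0) + J.card) = 2 * τ := by
    rw [← sub_eq_zero, ← mul_sub]
    apply aux_dbl h hd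
    rw [map_sub, ← hIJ, sub_eq_zero, map_add, map_add, map_sum, map_natCast]
    split_ifs <;> simp
  let p := if ε then u else v
  let p' := if ε then v else u
  let F : ZMod (2 * h) → List G := fun d => if d ∈ J then [Y d, Y (d + 1)] else [Y (d + 1), Y d]
  let s : ZMod (2 * h) → ZMod (2 * h) := fun d => if d ∈ J then -1 + M else 1 + M
  have hF : ∀ d, (F d).prod = e (s d) := by
    intro d
    by_cases hh : d ∈ J
    · simp [F, s, hh, H.YY]
    · simp [F, s, hh, H.YY]
  let L : List G := (A \ I).toList.map e ++ ([Y p] ++ (I.toList.map e ++ ([Y p'] ++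
    (D.toList.flatMap F ++ R.toList.map Y))))
  have hLlen : L.length = 2 * h := by
    have hFl : (D.toList.flatMap F).length = 2 * D.card := by
      have : ∀ d, (F d).length = 2 := by intro d; simp only [F]; split_ifs <;> rfl
      rw [List.length_flatMap]
      simp [this, mul_comm]
    have hAI := Finset.card_sdiff_add_card_eq_card hI
    simp only [L, List.length_append, List.length_map, Finset.length_toList, hFl, List.length_singleton]
    omega
  have hTc : (A.image e ∪ B.image Y).card = 2 * h := by
    rw [Finset.card_union_of_disjoint, Finset.card_image_of_injective _ H.einj,
      Finset.card_image_of_injective _ H.Yinj, hc]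
    rw [Finset.disjoint_left]
    intro a ha hb
    obtain ⟨i, _, rfl⟩ := Finset.mem_image.1 ha
    obtain ⟨j, _, hj⟩ := Finset.mem_image.1 hb
    exact H.disj _ _ hj.symm
  have hmem : ∀ z ∈ A.image e ∪ B.image Y, z ∈ L := by
    intro z hz
    rcases Finset.mem_union.1 hz with hz | hz
    · obtain ⟨a, ha, rfl⟩ := Finset.mem_image.1 hz
      by_cases haI : a ∈ I
      · have : e a ∈ I.toList.map e := List.mem_map.2 ⟨a, by simpa using haI, rfl⟩
        simp only [L, List.mem_append, this, true_or, or_true]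
      · have : e a ∈ (A \ I).toList.map e := List.mem_map.2 ⟨a, by simp [ha, haI], rfl⟩
        simp only [L, List.mem_append, this, true_or]
    · obtain ⟨b, hb, rfl⟩ := Finset.mem_image.1 hz
      by_cases hbR : b ∈ R
      · have : Y b ∈ R.toList.map Y := List.mem_map.2 ⟨b, by simpa using hbR, rfl⟩
        simp only [L, List.mem_append, this, or_true]
      · have hb2 : b ∈ (D ∪ D.image (· + 1)) ∪ {u, v} := by
          by_contra hh
          exact hbR (Finset.mem_sdiff.2 ⟨hb, hh⟩)
        simp only [Finset.mem_union, Finset.mem_image, Finset.mem_insert, Finset.mem_singleton] at hb2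
        have hpp : b = u ∨ b = v → Y b ∈ L := by
          intro hh
          have : b = p ∨ b = p' := by
            simp only [p, p']; split_ifs <;> tauto
          rcases this with hb | hb <;> simp [L, hb]
        rcases hb2 with (hz | ⟨d, hd, rfl⟩) | hb2
        · have : Y b ∈ D.toList.flatMap F := by
            refine List.mem_flatMap.2 ⟨b, by simpa using hz, ?_⟩
            simp only [F]; split_ifs <;> simp
          simp only [L, List.mem_append, this, true_or, or_true]
        · have : Y (d + 1) ∈ D.toList.flatMap F := by
            refine List.mem_flatMap.2 ⟨d, by simpa using hd, ?_⟩
            simp only [F]; split_ifs <;> simp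
          simp only [L, List.mem_append, this, true_or, or_true]
        · exact hpp hb2
  obtain ⟨hnd, hin⟩ := aux_list L _ hmem (hLlen.trans hTc.symm)
  refine ⟨L, hnd, hLlen, ?_, ?_⟩
  · intro z hz
    simpa using hin z hz
  · simp only [L, List.prod_append, List.prod_singleton]
    rw [aux_liste' H, aux_liste' H, hρ2, aux_liste H F s hF, H.ee, ← mul_assoc (e _) (Y p'), ← mul_assoc,
      H.eY, H.eY, H.Ye, H.YY, ← H.e0]
    congr 1
    have e1 : (A \ I).toList.sum = ∑ a ∈ A, a - ∑ a ∈ I, a := by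
      rw [Finset.sum_toList, ← Finset.sum_sdiff hI]; simp
    have e2 : I.toList.sum = ∑ a ∈ I, a := Finset.sum_toList I
    have e3 : (D.toList.map s).sum = D.card * (1 + M) - 2 * J.card := by
      rw [Finset.sum_map_toList]
      have : ∀ d ∈ D, s d = (1 + M) - (if d ∈ J then 2 else 0) := by
        intro d _
        simp only [s]; split_ifs <;> ring
      rw [Finset.sum_congr rfl this, Finset.sum_sub_distrib, Finset.sum_ite_mem,
        Finset.inter_eq_right.2 hJ]
      simp only [Finset.sum_const, nsmul_eq_mul]
      ring
    have e4 : p - p' = (v - u) - 2 * (if ε then v - u else 0) := by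
      simp only [p, p']; split_ifs <;> ring
    rw [e1, e2, e3]
    linear_combination e4 + hτ - hσ

theorem aux_mid {h : ℕ} [NeZero h] {G : Type} [Group G] {e Y : ZMod (2 * h) → G} {M : ZMod (2 * h)}
    {hd2 : 2 ∣ 2 * h} (H : AuxModel h e Y M hd2) (A B : Finset (ZMod (2 * h)))
    (hA : 4 ≤ A.card) (hB : 4 ≤ B.card)
    (hc : A.card + B.card = 2 * h) (hBe : Even B.card)
    (hpar : ∑ a ∈ A, ZMod.castHom hd2 (ZMod 2) a + ∑ a ∈ B, ZMod.castHom hd2 (ZMod 2) a = 0)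
    (hmix : (∃ a ∈ A, ZMod.castHom hd2 (ZMod 2) a ≠ 0) ∨
      ((∃ b ∈ B, ZMod.castHom hd2 (ZMod 2) b = 0) ∧ (∃ b ∈ B, ZMod.castHom hd2 (ZMod 2) b = 1))) :
    ∃ L : List G, L.Nodup ∧ L.length = 2 * h ∧
      (∀ z ∈ L, (∃ a ∈ A, e a = z) ∨ (∃ b ∈ B, Y b = z)) ∧ L.prod = 1 := by
  classical
  have hd : h ∣ 2 * h := ⟨2, by ring⟩
  by_cases hcase : A.card = h ∧ ¬ (∃ a ∈ A, ZMod.castHom hd2 (ZMod 2) a ≠ 0)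
  · obtain ⟨hAh, hno⟩ := hcase
    obtain ⟨⟨u, hu, hu0⟩, v, hv, hv1⟩ := hmix.resolve_left hno
    have hodd : ZMod.castHom hd2 (ZMod 2) (v - u) ≠ 0 := by
      rw [map_sub, hu0, hv1]; decide
    refine aux_construct H hd A B ∅ u v (by simp) (by simp) hu hv (by simp) (by simp) hc hBe hpar
      (by simp [hAh]) ?_ (Or.inr (Or.inr (Or.inr hodd)))
    intro hz
    apply hodd
    generalize v - u = z at hz
    obtain ⟨k, rfl⟩ := ZMod.intCast_surjective z
    rw [map_intCast, ZMod.intCast_zmod_eq_zero_iff_dvd] at hz ⊢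
    have : (2 : ℤ) ∣ h := by
      have : Even h := by
        have : B.card = h := by omega
        rwa [this] at hBe
      exact_mod_cast this.two_dvd
    exact this.trans hz
  · obtain ⟨D, hDB, hDc, hD1⟩ : ∃ D ⊆ B, D.card = h - A.card ∧
        (∀ d ∈ D, ZMod.castHom hd2 (ZMod 2) d = 0 ∧ d + 1 ∈ B) := by
      rcases Nat.lt_or_ge h A.card with hh | hh
      · exact ⟨∅, by simp, by simp; omega, by simp⟩
      · exact aux_cells h hd2 B _ (by omega)
    obtain ⟨u, hu, v, hv, hδ⟩ := aux_pair h hd (B \ (D ∪ D.image (· + 1))) (by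
      have h1 := Finset.le_card_sdiff (D ∪ D.image (· + 1)) B
      have h2 := Finset.card_union_le D (D.image (· + 1))
      have h3 : (D.image (· + 1)).card ≤ D.card := Finset.card_image_le
      omega)
    rw [Finset.mem_sdiff] at hu hv
    refine aux_construct H hd A B D u v hDB hD1 hu.1 hv.1 hu.2 hv.2 hc hBe hpar (by omega) hδ ?_
    rcases not_and_or.1 hcase with hh | hh
    · exact Or.inl (fun h => hh h.symm)
    · exact Or.inr (Or.inr (Or.inl (not_not.1 hh)))

theorem aux_main {h : ℕ} [NeZero h] {G : Type} [Group G] {e Y : ZMod (2 * h) → G} {M : ZMod (2 * h)}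
    {hd2 : 2 ∣ 2 * h} (H : AuxModel h e Y M hd2) (A B : Finset (ZMod (2 * h)))
    (hA : 5 ≤ A.card) (hB : 5 ≤ B.card)
    (hc : A.card + B.card = 2 * h + 1)
    (hAm : ∀ t, ∃ a ∈ A, ZMod.castHom hd2 (ZMod 2) a = t)
    (hBm : ∀ t, ∃ a ∈ B, ZMod.castHom hd2 (ZMod 2) a = t) :
    ∃ L : List G, L.Nodup ∧ L.length = 2 * h ∧
      (∀ z ∈ L, (∃ a ∈ A, e a = z) ∨ (∃ b ∈ B, Y b = z)) ∧ L.prod = 1 := by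
  classical
  by_cases hBe : Even B.card
  · obtain ⟨a0, ha0, hp⟩ := hAm (∑ a ∈ A, ZMod.castHom hd2 (ZMod 2) a + ∑ a ∈ B, ZMod.castHom hd2 (ZMod 2) a)
    have hcA := Finset.card_erase_of_mem ha0
    obtain ⟨L, h1, h2, h3, h4⟩ := aux_mid H (A.erase a0) B (by omega) (by omega) (by omega) hBe (by
      rw [← Finset.add_sum_erase _ _ ha0] at hp
      linear_combination -hp) (Or.inr ⟨hBm 0, hBm 1⟩)
    refine ⟨L, h1, h2, fun z hz => ?_, h4⟩
    rcases h3 z hz with ⟨a, ha, hh⟩ | hh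
    · exact Or.inl ⟨a, Finset.mem_of_mem_erase ha, hh⟩
    · exact Or.inr hh
  · obtain ⟨a0, ha0, hp⟩ := hBm (∑ a ∈ A, ZMod.castHom hd2 (ZMod 2) a + ∑ a ∈ B, ZMod.castHom hd2 (ZMod 2) a)
    have hcB := Finset.card_erase_of_mem ha0
    obtain ⟨L, h1, h2, h3, h4⟩ := aux_mid H A (B.erase a0) (by omega) (by omega) (by omega) (by grind) (by
      rw [← Finset.add_sum_erase _ _ ha0] at hp
      linear_combination -hp) (Or.inl (by
        obtain ⟨a, ha, hh⟩ := hAm 1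
        exact ⟨a, ha, by rw [hh]; decide⟩))
    refine ⟨L, h1, h2, fun z hz => ?_, h4⟩
    rcases h3 z hz with hh | ⟨a, ha, hh⟩
    · exact Or.inl hh
    · exact Or.inr ⟨a, Finset.mem_of_mem_erase ha, hh⟩

theorem aux_model (h : ℕ) [NeZero h] (hd2 : 2 ∣ 2 * h) (m : ℤ) (hm : Even m) (G : Type) [Group G] [Fintype G]
    (x y : G) (hG : Fintype.card G = 2 * (2 * h)) (hx : orderOf x = 2 * h) (hy : y ^ 2 = x ^ m)
    (hyx : y * x = x⁻¹ * y) (hcl : Subgroup.closure {x, y} = ⊤) :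
    ∃ e Y : ZMod (2 * h) → G, ∃ M, AuxModel h e Y M hd2 := by
  let f : {f : ℤ →+ Additive G // f ((2 * h : ℕ) : ℤ) = 0} :=
    ⟨zmultiplesHom _ (Additive.ofMul x), by
      rw [zmultiplesHom_apply, natCast_zsmul, ← ofMul_pow, ← hx, pow_orderOf_eq_one]; rfl⟩
  let e : ZMod (2 * h) → G := fun i => (ZMod.lift (2 * h) f i).toMul
  have eI : ∀ k : ℤ, e (k : ZMod (2 * h)) = x ^ k := by
    intro k
    simp only [e, ZMod.lift_coe, f, zmultiplesHom_apply]
    rfl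
  have ee : ∀ i j, e i * e j = e (i + j) := by
    intro i j
    simp only [e, map_add]; rfl
  have ye : ∀ j, y * e j = e (-j) * y := by
    intro j
    obtain ⟨k, rfl⟩ := ZMod.intCast_surjective j
    rw [← Int.cast_neg, eI, eI]
    have h1 : SemiconjBy y x x⁻¹ := hyx
    have := h1.zpow_right k
    rw [inv_zpow, ← zpow_neg] at this
    exact this
  have einj : Function.Injective e := by
    intro i j hij
    obtain ⟨k, rfl⟩ := ZMod.intCast_surjective i
    obtain ⟨l, rfl⟩ := ZMod.intCast_surjective j
    rw [eI, eI] at hij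
    rw [ZMod.intCast_eq_intCast_iff, ← hx]
    exact zpow_eq_zpow_iff_modEq.1 hij
  refine ⟨e, fun i => e i * y, (m : ZMod (2 * h)), ⟨?_, ee, ?_, ?_, ?_, einj, ?_, ?_, ?_⟩⟩
  · simpa using eI 0
  · intro i j; simp only [← mul_assoc, ee]
  · intro i j
    change e i * y * e j = e (i - j) * y
    rw [mul_assoc, ye, ← mul_assoc, ee, sub_eq_add_neg]
  · intro i j
    change e i * y * (e j * y) = _
    rw [mul_assoc, ← mul_assoc y, ye, mul_assoc, ← pow_two, hy, ← eI, ee, ee]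
    congr 1; ring
  · intro i j hij
    exact einj (mul_right_cancel hij)
  · intro i j hij
    have hyz : y ∈ Subgroup.zpowers x := by
      have : y = e (-j + i) := by
        rw [← ee, hij, ← mul_assoc, ee]
        simp [e]
      rw [this]
      obtain ⟨k, hk⟩ := ZMod.intCast_surjective (-j + i)
      rw [← hk, eI]
      exact Subgroup.zpow_mem_zpowers x k
    have htop : Subgroup.zpowers x = ⊤ := by
      rw [eq_top_iff, ← hcl, Subgroup.closure_le]
      intro z hz
      rcases hz with rfl | hz
      · exact Subgroup.mem_zpowers _
      · rw [Set.mem_singleton_iff] at hz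
        rw [hz]; exact hyz
    have h1 := Nat.card_zpowers x
    rw [htop, Subgroup.card_top, Nat.card_eq_fintype_card, hG, hx] at h1
    have := NeZero.ne h
    omega
  · rw [map_intCast, ZMod.intCast_zmod_eq_zero_iff_dvd]
    exact_mod_cast hm.two_dvd

theorem aux_parity_card (h : ℕ) [NeZero h] (hd2 : 2 ∣ 2 * h) (t : ZMod 2) :
    (Finset.univ.filter (fun i : ZMod (2 * h) => ZMod.castHom hd2 (ZMod 2) i = t)).card = h := by
  classical
  let π := ZMod.castHom hd2 (ZMod 2)
  have h1 : ∀ t, (Finset.univ.filter (fun i => π i = t)).card ≤ (Finset.univ.filter (fun i => π i = t + 1)).card := by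
    intro t
    apply Finset.card_le_card_of_injOn (fun i => i + 1)
    · intro i hi
      have := (Finset.mem_filter.1 hi).2
      simp only [Finset.coe_filter, Finset.mem_univ, true_and, Set.mem_ofPred_eq]
      rw [map_add, this, map_one]
    · intro i _ j _ hij
      exact add_left_injective _ hij
  have h2 := h1 t
  have h3 := h1 (t + 1)
  have h4 : ∀ t : ZMod 2, t + 1 + 1 = t := by decide
  rw [h4] at h3
  have h5 := Finset.card_filter_add_card_filter_not (s := Finset.univ) (fun i => π i = t)
  have h6 : (Finset.univ.filter (fun i => ¬ π i = t)) = (Finset.univ.filter (fun i => π i = t + 1)) := by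
    have : ∀ s t : ZMod 2, ¬ s = t ↔ s = t + 1 := by decide
    ext i; simp only [Finset.mem_filter, this]
  rw [h6, Finset.card_univ, ZMod.card] at h5
  change (Finset.univ.filter (fun i => π i = t)).card = h
  omega

theorem aux_count (h : ℕ) [NeZero h] (hd2 : 2 ∣ 2 * h) (G : Type) [Group G] [Fintype G]
    (hG : Fintype.card G = 2 * (2 * h)) (e Y : ZMod (2 * h) → G) (M : ZMod (2 * h))
    (H : AuxModel h e Y M hd2) :
    {S : Finset G | S.card = 2 * h + 1 ∧ (1 : G) ∉ prodTuples (2 * h) (S : Set G)}.ncard ≤ 5124 * 8 ^ h := by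
  classical
  have hh0 := NeZero.pos h
  let π := ZMod.castHom hd2 (ZMod 2)
  let Xs : (ZMod (2 * h) → G) → ZMod 2 → Finset G := fun F t =>
    (Finset.univ.filter (fun i => π i = t)).image F
  have hXc : ∀ F : ZMod (2 * h) → G, Function.Injective F → ∀ t, (Xs F t).card = h := by
    intro F hF t
    simp only [Xs]
    rw [Finset.card_image_of_injective _ hF]
    exact aux_parity_card h hd2 t
  let av : Finset G → Finset (Finset G) := fun X => Finset.univ.filter (fun S : Finset G => ∀ z ∈ X, z ∉ S)
  let few : Finset G → Finset (Finset G) := fun E => Finset.univ.filter (fun S : Finset G => (S ∩ E).card ≤ 4)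
  have hav : ∀ F : ZMod (2 * h) → G, Function.Injective F → ∀ t, (av (Xs F t)).card = 8 ^ h :=
    fun F hF t => aux_avoid _ h (hXc F hF t) (by omega)
  have hec : ∀ F : ZMod (2 * h) → G, Function.Injective F → (Finset.univ.image F).card = 2 * h := by
    intro F hF
    rw [Finset.card_image_of_injective _ hF, Finset.card_univ, ZMod.card]
  have hfew : ∀ F : ZMod (2 * h) → G, Function.Injective F → (few (Finset.univ.image F)).card ≤ 2560 * 8 ^ h := by
    intro F hF
    refine (aux_few _ (2 * h) (by omega) (hec F hF) hG).trans ?_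
    have := aux_pow4 h
    calc 5 * (2 * h) ^ 4 * 2 ^ (2 * h) = 80 * h ^ 4 * 4 ^ h := by rw [pow_mul]; norm_num; ring
      _ ≤ 80 * (32 * 2 ^ h) * 4 ^ h := by gcongr
      _ = 2560 * (2 * 4) ^ h := by rw [mul_pow]; ring
      _ = _ := by norm_num
  have hdisj : ∀ (P Q : Finset (ZMod (2 * h))), Disjoint (P.image e) (Q.image Y) := by
    intro P Q
    rw [Finset.disjoint_left]
    intro a ha hb
    obtain ⟨i, _, rfl⟩ := Finset.mem_image.1 ha
    obtain ⟨j, _, hj⟩ := Finset.mem_image.1 hb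
    exact H.disj _ _ hj.symm
  have hcov : Finset.univ.image e ∪ Finset.univ.image Y = Finset.univ := by
    rw [← Finset.card_eq_iff_eq_univ, Finset.card_union_of_disjoint (hdisj _ _), hec e H.einj,
      hec Y H.Yinj, hG]
    ring
  have hsub : {S : Finset G | S.card = 2 * h + 1 ∧ (1 : G) ∉ prodTuples (2 * h) (S : Set G)} ⊆
      ((av (Xs e 0) ∪ av (Xs e 1) ∪ (av (Xs Y 0) ∪ av (Xs Y 1)) ∪
        (few (Finset.univ.image e) ∪ few (Finset.univ.image Y)) : Finset (Finset G)) : Set (Finset G)) := by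
    rintro S ⟨hS, hbad⟩
    by_contra hcon
    apply hbad
    simp only [Finset.coe_union, Set.mem_union, Finset.mem_coe, not_or] at hcon
    obtain ⟨⟨⟨c1, c2⟩, c3, c4⟩, c5, c6⟩ := hcon
    have hav' : ∀ F t, S ∉ av (Xs F t) →
        ∃ i ∈ Finset.univ.filter (fun i => F i ∈ S), π i = t := by
      intro F t hS
      simp only [av, Finset.mem_filter, Finset.mem_univ, true_and] at hS
      push Not at hS
      obtain ⟨z, hz, hzS⟩ := hS
      obtain ⟨i, hi, rfl⟩ := Finset.mem_image.1 hz
      exact ⟨i, by simpa using hzS, (Finset.mem_filter.1 hi).2⟩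
    have him : ∀ F : ZMod (2 * h) → G, (Finset.univ.filter (fun i => F i ∈ S)).image F = S ∩ Finset.univ.image F := by
      intro F
      ext z
      simp only [Finset.mem_image, Finset.mem_filter, Finset.mem_univ, true_and, Finset.mem_inter]
      constructor
      · rintro ⟨i, hi, rfl⟩; exact ⟨hi, i, rfl⟩
      · rintro ⟨hi, i, rfl⟩; exact ⟨i, hi, rfl⟩
    have himc : ∀ F : ZMod (2 * h) → G, Function.Injective F →
        (Finset.univ.filter (fun i => F i ∈ S)).card = (S ∩ Finset.univ.image F).card := by
      intro F hF
      rw [← him, Finset.card_image_of_injective _ hF]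
    have hfew' : ∀ F : ZMod (2 * h) → G, Function.Injective F → S ∉ few (Finset.univ.image F) →
        5 ≤ (Finset.univ.filter (fun i => F i ∈ S)).card := by
      intro F hF hS
      simp only [few, Finset.mem_filter, Finset.mem_univ, true_and] at hS
      rw [himc F hF]; omega
    have h01 : ∀ t : ZMod 2, t = 0 ∨ t = 1 := by decide
    obtain ⟨L, h1, h2, h3, h4⟩ := aux_main H (Finset.univ.filter (fun i => e i ∈ S))
      (Finset.univ.filter (fun i => Y i ∈ S)) (hfew' e H.einj c5) (hfew' Y H.Yinj c6) (by
        rw [himc e H.einj, himc Y H.Yinj, ← hS]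
        rw [← Finset.card_union_of_disjoint]
        · rw [← Finset.inter_union_distrib_left, hcov, Finset.inter_univ]
        · rw [← him, ← him]; exact hdisj _ _) (by
        intro t
        rcases h01 t with rfl | rfl
        · exact hav' e _ c1
        · exact hav' e _ c2) (by
        intro t
        rcases h01 t with rfl | rfl
        · exact hav' Y _ c3
        · exact hav' Y _ c4)
    refine ⟨L, h1, h2, fun z hz => ?_, h4⟩
    rcases h3 z hz with ⟨i, hi, rfl⟩ | ⟨i, hi, rfl⟩
    · exact (Finset.mem_filter.1 hi).2
    · exact (Finset.mem_filter.1 hi).2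
  refine (Set.ncard_le_ncard hsub (Finset.finite_toSet _)).trans ?_
  rw [Set.ncard_coe_finset]
  have u1 := Finset.card_union_le (av (Xs e 0)) (av (Xs e 1))
  have u2 := Finset.card_union_le (av (Xs Y 0)) (av (Xs Y 1))
  have u3 := Finset.card_union_le (av (Xs e 0) ∪ av (Xs e 1)) (av (Xs Y 0) ∪ av (Xs Y 1))
  have u4 := Finset.card_union_le (few (Finset.univ.image e)) (few (Finset.univ.image Y))
  have u5 := Finset.card_union_le (av (Xs e 0) ∪ av (Xs e 1) ∪ (av (Xs Y 0) ∪ av (Xs Y 1)))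
    (few (Finset.univ.image e) ∪ few (Finset.univ.image Y))
  have v1 := hav e H.einj 0
  have v2 := hav e H.einj 1
  have v3 := hav Y H.Yinj 0
  have v4 := hav Y H.Yinj 1
  have v5 := hfew e H.einj
  have v6 := hfew Y H.Yinj
  omega

/-- There is an absolute constant `C > 0` such that for all even `n ≥ 2` and even `m`,
the proportion of `(n+1)`-element subsets of `H_{n,m}` containing no `n` distinct elements
with product `1` is less than `C √(n/2^n)`. -/
theorem prob_failing_card_n_add_one_lt :
    ∃ C : ℝ, 0 < C ∧ ∀ (n : ℕ) (m : ℤ), 2 ≤ n → Even n → Even m →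
      ∀ (G : Type) [Group G] [Fintype G], ∀ x y : G,
        Fintype.card G = 2 * n → orderOf x = n → y ^ 2 = x ^ m → y * x = x⁻¹ * y →
        Subgroup.closure {x, y} = ⊤ →
        (Set.ncard {S : Finset G | S.card = n + 1 ∧
            (1 : G) ∉ prodTuples n (S : Set G)} : ℝ) /
          (Nat.choose (2 * n) (n + 1)) < C * Real.sqrt ((n : ℝ) / 2 ^ n) := by
  refine ⟨30000, by norm_num, ?_⟩
  intro n m hn hne hm G _ _ x y hG hx hy hyx hcl
  obtain ⟨h, rfl⟩ := even_iff_exists_two_mul.1 hne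
  have hne0 : NeZero h := ⟨by omega⟩
  have hd2 : 2 ∣ 2 * h := Dvd.intro h rfl
  obtain ⟨e, Y, M, H⟩ := aux_model h hd2 m hm G x y hG hx hy hyx hcl
  have h1 := aux_count h hd2 G hG e Y M H
  have h1' : (Set.ncard {S : Finset G | S.card = 2 * h + 1 ∧
            (1 : G) ∉ prodTuples (2 * h) (S : Set G)} : ℝ) ≤ 5124 * 8 ^ h := by exact_mod_cast h1
  have h2 := aux_choose (2 * h) (by omega)
  have hcp : 0 < ((2 * (2 * h)).choose (2 * h + 1) : ℝ) := by
    exact_mod_cast Nat.choose_pos (by omega)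
  rw [div_lt_iff₀ hcp]
  refine h1'.trans_lt ?_
  have h3 : Real.sqrt (((2 * h : ℕ) : ℝ) / 2 ^ (2 * h)) = Real.sqrt ((2 * h : ℕ) : ℝ) / 2 ^ h := by
    rw [Real.sqrt_div (by positivity), mul_comm 2 h, pow_mul, Real.sqrt_sq (by positivity)]
  rw [h3]
  have h4 : (4 : ℝ) ^ (2 * h) = 8 ^ h * 2 ^ h := by
    rw [pow_mul, ← mul_pow]; norm_num
  rw [h4] at h2
  have h5 : (8 : ℝ) ^ h ≤ 4 * (Real.sqrt ((2 * h : ℕ) : ℝ) / 2 ^ h * ((2 * (2 * h)).choose (2 * h + 1) : ℝ)) := by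
    have : (0:ℝ) < 2 ^ h := by positivity
    rw [← mul_le_mul_iff_left₀ this]
    refine h2.trans (le_of_eq ?_)
    field_simp
  have h6 : (0 : ℝ) < 8 ^ h := by positivity
  nlinarith
end

section
/- Let n ≥ 2 be odd, m an integer, and G ≅ H_{n,m} with generators x, y as above. Then the Harborth constant satisfies 𝔤(G) = 2n + 1; equivalently, since exp(G) = 2n = |G|, there is no ordering of all 2n elements of G whose product is 1. -/
open Classical in
theorem aux_prod_mem {G : Type*} [Group G] (N : Subgroup G) (h2 : N.index = 2) (l : List G) :
    l.prod ∈ N ↔ Even (l.filter (fun g => g ∉ N)).length := by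
  induction l with
  | nil => simp [N.one_mem]
  | cons a l ih =>
    rw [List.prod_cons, Subgroup.mul_mem_iff_of_index_two h2, ih]
    by_cases ha : a ∈ N
    · simp [ha]
    · simp [ha, Nat.even_add_one]

/-- For `n ≥ 2` odd, the Harborth constant of `H_{n,m}` is `2n + 1`: since
`exp(H_{n,m}) = 2n = |H_{n,m}|`, equivalently there is no ordering of all `2n`
elements of the group whose product is `1`. -/
theorem harborth_of_odd (n : ℕ) (m : ℤ) (hn : 2 ≤ n) (hodd : Odd n)
    {G : Type*} [Group G] [Fintype G]
    (hG : Fintype.card G = 2 * n) (x y : G)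
    (hx : orderOf x = n) (hy : y ^ 2 = x ^ m) (hyx : y * x = x⁻¹ * y)
    (hgen : Subgroup.closure {x, y} = ⊤) :
    ¬ ∃ l : List G, l.Nodup ∧ l.length = 2 * n ∧ (∀ g : G, g ∈ l) ∧ l.prod = 1 := by
  classical
  rintro ⟨l, hnd, -, hall, hprod⟩
  have hN : Nat.card (Subgroup.zpowers x) = n := by rw [Nat.card_zpowers, hx]
  have h2 : (Subgroup.zpowers x).index = 2 := by
    have h := (Subgroup.zpowers x).card_mul_index
    rw [hN, Nat.card_eq_fintype_card, hG, mul_comm 2 n] at h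
    exact Nat.eq_of_mul_eq_mul_left (by omega) h
  have h1 := (aux_prod_mem _ h2 l).1 (by rw [hprod]; exact one_mem _)
  have hc : (l.filter (fun g => g ∉ Subgroup.zpowers x)).length = n := by
    rw [← List.toFinset_card_of_nodup (hnd.filter _)]
    have e : (l.filter (fun g => g ∉ Subgroup.zpowers x)).toFinset
        = (Finset.univ.filter (fun g => g ∈ Subgroup.zpowers x))ᶜ := by
      ext g; simp [hall g]
    have c : (Finset.univ.filter (fun g => g ∈ Subgroup.zpowers x)).card = n := by
      rw [← Fintype.card_subtype, ← Nat.card_eq_fintype_card]; exact hN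
    rw [e, Finset.card_compl, c, hG]; omega
  rw [hc] at h1
  exact (Nat.not_even_iff_odd.2 hodd) h1
end

section
/- Let n ≥ 2 with n ≡ 2 (mod 4), let m be odd, and let G ≅ H_{n,m} with generators x, y as above. Then the Harborth constant satisfies 𝔤(G) = 2n + 1; equivalently, since exp(G) = 2n = |G|, there is no ordering of all 2n elements of G whose product is 1. -/
/-- For `n ≡ 2 (mod 4)` and `m` odd, the Harborth constant of `H_{n,m}` is `2n + 1`: since
`exp(H_{n,m}) = 2n = |H_{n,m}|`, equivalently there is no ordering of all `2n` elements
of the group whose product is `1`. -/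
theorem harborth_of_two_mod_four (n : ℕ) (m : ℤ) (hn : 2 ≤ n) (hn4 : n % 4 = 2) (hm : Odd m)
    {G : Type*} [Group G] [Fintype G]
    (hG : Fintype.card G = 2 * n) (x y : G)
    (hx : orderOf x = n) (hy : y ^ 2 = x ^ m) (hyx : y * x = x⁻¹ * y)
    (hgen : Subgroup.closure {x, y} = ⊤) :
    ¬ ∃ l : List G, l.Nodup ∧ l.length = 2 * n ∧ (∀ g : G, g ∈ l) ∧ l.prod = 1 := by
  classical
  rintro ⟨l, hnd, -, hall, hprod⟩
  have hconj : ∀ g : G, g * x * g⁻¹ = x ∨ g * x * g⁻¹ = x⁻¹ := by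
    intro g
    have hg : g ∈ Subgroup.closure {x, y} := by rw [hgen]; trivial
    induction hg using Subgroup.closure_induction with
    | mem a ha =>
      rcases ha with rfl | rfl
      · left; group
      · right; rw [hyx]; group
    | one => left; group
    | mul a b _ _ ha hb =>
      have e : a * b * x * (a * b)⁻¹ = a * (b * x * b⁻¹) * a⁻¹ := by group
      have e2 : a * x⁻¹ * a⁻¹ = (a * x * a⁻¹)⁻¹ := by group
      rw [e]
      rcases hb with hb | hb <;> rw [hb]
      · exact ha
      · rw [e2]
        rcases ha with ha | ha <;> rw [ha] <;> simp
    | inv a _ ha =>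
      rcases ha with ha | ha
      · left
        calc a⁻¹ * x * a⁻¹⁻¹ = a⁻¹ * (a * x * a⁻¹) * a := by rw [ha]; group
          _ = x := by group
      · right
        calc a⁻¹ * x * a⁻¹⁻¹ = a⁻¹ * (x⁻¹)⁻¹ * a := by group
          _ = a⁻¹ * (a * x * a⁻¹)⁻¹ * a := by rw [ha]
          _ = x⁻¹ := by group
  let N : Subgroup G := Subgroup.zpowers (x ^ 2)
  have hN : N.Normal := by
    constructor
    intro a ha g
    obtain ⟨i, rfl⟩ := Subgroup.mem_zpowers_iff.1 ha
    rw [← conj_zpow, ← conj_pow]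
    refine Subgroup.zpow_mem _ ?_ _
    rcases hconj g with h | h <;> rw [h]
    · exact Subgroup.mem_zpowers _
    · rw [inv_pow]; exact N.inv_mem (Subgroup.mem_zpowers _)
  obtain ⟨k, hk, hkodd⟩ : ∃ k, n = 2 * k ∧ k % 2 = 1 := ⟨n / 2, by omega, by omega⟩
  have hcN : Nat.card N = k := by
    rw [Nat.card_zpowers, orderOf_pow, hx, hk, Nat.gcd_mul_right_left, Nat.mul_div_cancel_left _ (by norm_num)]
  have hcQ : Nat.card (G ⧸ N) = 4 := by
    have h := N.card_eq_card_quotient_mul_card_subgroup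
    rw [hcN, Nat.card_eq_fintype_card, hG, hk] at h
    have : 0 < k := by omega
    apply Nat.eq_of_mul_eq_mul_right this
    rw [← h]; ring
  let f : G →* G ⧸ N := QuotientGroup.mk' N
  have hX1 : f x ≠ 1 := by
    intro h
    have h1 : x ∈ N := (QuotientGroup.eq_one_iff x).1 h
    obtain ⟨i, hi⟩ := Subgroup.mem_zpowers_iff.1 h1
    have h2 : x ^ (2 * i - 1) = 1 := by
      rw [zpow_sub, zpow_mul, zpow_one, zpow_ofNat, hi, mul_inv_cancel]
    have h3 := orderOf_dvd_iff_zpow_eq_one.2 h2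
    rw [hx, hk] at h3
    push_cast at h3
    have h4 : (2 : ℤ) ∣ 2 * i - 1 := (Dvd.intro _ rfl).trans h3
    omega
  have hX2 : f x ^ 2 = 1 := by
    rw [← map_pow]
    exact (QuotientGroup.eq_one_iff _).2 (Subgroup.mem_zpowers _)
  have hY2 : f y ^ 2 = f x := by
    obtain ⟨j, rfl⟩ := hm
    rw [← map_pow, hy, map_zpow, zpow_add, zpow_mul, zpow_ofNat, hX2]; simp
  have hY4 : f y ^ 4 = 1 := by
    rw [show 4 = 2 * 2 from rfl, pow_mul, hY2, hX2]
  have hoY : orderOf (f y) = 4 := by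
    have := orderOf_eq_prime_pow (p := 2) (n := 1) (x := f y) (by simpa [hY2] using hX1)
      (by simpa using hY4)
    simpa using this
  have hgenQ : ∀ q : G ⧸ N, q ∈ Subgroup.zpowers (f y) := by
    have : Subgroup.zpowers (f y) = ⊤ := by
      apply Subgroup.eq_top_of_card_eq
      rw [Nat.card_zpowers, hoY, hcQ]
    intro q; rw [this]; trivial
  let _ : CommGroup (G ⧸ N) :=
    { (inferInstance : Group (G ⧸ N)) with
      mul_comm := by
        intro a b
        obtain ⟨i, rfl⟩ := Subgroup.mem_zpowers_iff.1 (hgenQ a)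
        obtain ⟨j, rfl⟩ := Subgroup.mem_zpowers_iff.1 (hgenQ b)
        exact ((Commute.refl (f y)).zpow_zpow i j).eq }
  have hl : (l.map f).prod = ∏ g : G, f g := by
    rw [← List.prod_toFinset f hnd]
    congr 1
    ext g; simp [hall g]
  have hfib : ∀ q : G ⧸ N, (Finset.univ.filter (fun g => f g = q)).card = k := by
    intro q
    obtain ⟨a, rfl⟩ := QuotientGroup.mk'_surjective N q
    rw [MonoidHom.card_fiber_eq_of_mem_range f ⟨a, rfl⟩ ⟨1, map_one f⟩, ← hcN,
      Nat.card_eq_fintype_card, Fintype.card_subtype]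
    congr 1
    ext g
    simp only [Finset.mem_filter, Finset.mem_univ, true_and]
    exact QuotientGroup.eq_one_iff g
  have h1 : ∏ g : G, f g = (∏ q : G ⧸ N, q) ^ k := by
    rw [← Finset.prod_fiberwise (s := Finset.univ) (g := f), ← Finset.prod_pow]
    apply Finset.prod_congr rfl
    intro q _
    rw [Finset.prod_congr rfl (g := fun _ => q) (by intro g hg; simpa using hg),
      Finset.prod_const, hfib]
  have h2 : ∏ q : G ⧸ N, q = f x := by
    rw [← IsCyclic.image_range_orderOf hgenQ, Finset.prod_image]
    · rw [hoY]
      simp only [Finset.prod_range_succ, Finset.prod_range_zero]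
      rw [one_mul, ← pow_add, ← pow_add, ← pow_add]
      rw [show 0 + 1 + 2 + 3 = 4 + 2 from rfl, pow_add, hY4, hY2, one_mul]
    · intro a ha b hb hab
      exact pow_injOn_Iio_orderOf (by simpa using ha) (by simpa using hb) hab
  have h3 : f x ^ k = f x := by
    obtain ⟨j, rfl⟩ : ∃ j, k = 2 * j + 1 := ⟨k / 2, by omega⟩
    rw [pow_succ, pow_mul, hX2, one_pow, one_mul]
  apply hX1
  rw [← h3, ← h2, ← h1, ← hl]
  have h5 := map_list_prod f l
  rw [hprod, map_one] at h5
  exact h5.symm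
end

section
/- Let n ≥ 4 and m be even integers, and let G ≅ H_{n,m} with generators x, y as above. Then the Harborth constant satisfies 𝔤(G) = n + 2; that is, every subset of G of size n + 2 contains n distinct elements whose product in some order is 1, and there exists a subset of G of size n + 1 containing no n distinct elements whose product in some order is 1. -/
theorem hb_cover {α : Type*} [DecidableEq α] (d : α → ℤ) (k : ℕ) : ∀ (s : Finset α), s.card = k →
    (∀ i ∈ s, 1 ≤ d i) → (∀ i ∈ s, d i ≤ k) → (∑ i ∈ s, d i ≤ 2 * k) → (∃ i ∈ s, d i = 1) →
    ∀ t : ℤ, 0 ≤ t → t ≤ ∑ i ∈ s, d i → ∃ U ⊆ s, ∑ i ∈ U, d i = t := by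
  induction k with
  | zero =>
    intro s hs h1 h2 h3 h4
    obtain ⟨i, hi, _⟩ := h4
    rw [Finset.card_eq_zero.mp hs] at hi
    simp at hi
  | succ k ih =>
    intro s hs h1 h2 h3 h4 t ht0 ht
    obtain ⟨j, hj, hj1⟩ := h4
    obtain ⟨i0, hi0, hmax⟩ := Finset.exists_max_image s d ⟨j, hj⟩
    have hc : (s.erase i0).card = k := by rw [Finset.card_erase_of_mem hi0]; omega
    have hsum : d i0 + ∑ i ∈ s.erase i0, d i = ∑ i ∈ s, d i := Finset.add_sum_erase s d hi0
    have hlow : ∀ u : Finset α, u ⊆ s → (u.card : ℤ) ≤ ∑ i ∈ u, d i := by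
      intro u hu
      have := Finset.card_nsmul_le_sum u d 1 (fun i hi => h1 i (hu hi))
      simpa using this
    have hl := hlow _ (Finset.erase_subset i0 s)
    rw [hc] at hl
    have hd0 := h2 i0 hi0
    have hd1 := h1 i0 hi0
    push_cast at hd0 h3
    rcases Nat.eq_zero_or_pos k with hk | hk
    · subst hk
      rw [Finset.card_eq_zero] at hc
      rw [hc] at hsum
      simp at hsum hd0
      rcases eq_or_ne t 0 with h | h
      · exact ⟨∅, by simp, by simp [h]⟩
      · exact ⟨s, le_rfl, by omega⟩
    have hrec : ∀ t : ℤ, 0 ≤ t → t ≤ ∑ i ∈ s.erase i0, d i →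
        ∃ U ⊆ s.erase i0, ∑ i ∈ U, d i = t := by
      apply ih _ hc
      · exact fun i hi => h1 i (Finset.mem_of_mem_erase hi)
      · intro i hi
        by_contra hcon
        push Not at hcon
        have him := hmax i (Finset.mem_of_mem_erase hi)
        have e2 := Finset.add_sum_erase _ d hi
        have l2 := hlow ((s.erase i0).erase i)
          ((Finset.erase_subset _ _).trans (Finset.erase_subset _ _))
        rw [Finset.card_erase_of_mem hi, hc] at l2
        have hk1 : k = 1 := by omega
        subst hk1
        have hji : j ≠ i := by rintro rfl; omega
        have hji0 : j ≠ i0 := by rintro rfl; omega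
        have : ({j, i, i0} : Finset α).card ≤ s.card := Finset.card_le_card (by
          intro z hz; simp at hz
          rcases hz with rfl | rfl | rfl
          · exact hj
          · exact Finset.mem_of_mem_erase hi
          · exact hi0)
        have hii : i ≠ i0 := Finset.ne_of_mem_erase hi
        rw [Finset.card_insert_of_notMem (by simp [hji, hji0]), Finset.card_pair hii] at this
        omega
      · by_cases h : d i0 = 1
        · have : ∑ i ∈ s.erase i0, d i ≤ (s.erase i0).card • 1 := Finset.sum_le_card_nsmul (s.erase i0) d 1
            (fun i hi => h ▸ hmax i (Finset.mem_of_mem_erase hi))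
          rw [hc] at this
          simp at this
          omega
        · omega
      · by_cases h : j = i0
        · obtain ⟨z, hz⟩ : (s.erase i0).Nonempty := by
            rw [← Finset.card_pos]; omega
          refine ⟨z, hz, le_antisymm ?_ (h1 z (Finset.mem_of_mem_erase hz))⟩
          rw [← hj1, h]
          exact hmax z (Finset.mem_of_mem_erase hz)
        · exact ⟨j, Finset.mem_erase.mpr ⟨h, hj⟩, hj1⟩
    by_cases hcase : t ≤ ∑ i ∈ s.erase i0, d i
    · obtain ⟨U, hU, e⟩ := hrec t ht0 hcase
      exact ⟨U, hU.trans (Finset.erase_subset _ _), e⟩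
    · obtain ⟨U, hU, e⟩ := hrec (t - d i0) (by omega) (by omega)
      refine ⟨insert i0 U, ?_, ?_⟩
      · intro z hz
        rcases Finset.mem_insert.mp hz with rfl | hz
        · exact hi0
        · exact Finset.mem_of_mem_erase (hU hz)
      · rw [Finset.sum_insert (fun h => Finset.notMem_erase i0 s (hU h)), e]; ring

theorem hb_orient {α : Type*} [DecidableEq α] (d : α → ℤ) (L : List α) (hL : L.Nodup)
    (h1 : ∀ i ∈ L, 1 ≤ d i) (h2 : ∀ i ∈ L, d i ≤ L.length)
    (h3 : (L.map d).sum ≤ 2 * L.length) (h4 : ∃ i ∈ L, d i = 1)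
    (τ : ℤ) (hτ0 : 0 ≤ τ) (hτ : τ ≤ (L.map d).sum) (hp : 2 ∣ (L.map d).sum - τ) :
    ∃ U : α → Prop, ∃ _ : DecidablePred U, (L.map (fun i => if U i then d i else - d i)).sum = τ := by
  have hcard : L.toFinset.card = L.length := List.toFinset_card_of_nodup hL
  have hs : ∑ i ∈ L.toFinset, d i = (L.map d).sum := List.sum_toFinset d hL
  obtain ⟨c, hc⟩ := hp
  obtain ⟨U, hU, e⟩ := hb_cover d L.length L.toFinset hcard (by simpa using h1) (by simpa using h2)
    (by rw [hs]; exact h3) (by simpa using h4) (c + τ) (by omega) (by omega)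
  refine ⟨fun i => i ∈ U, inferInstance, ?_⟩
  rw [← List.sum_toFinset _ hL]
  have : ∀ i, (if i ∈ U then d i else - d i) = 2 * (if i ∈ U then d i else 0) - d i := by
    intro i; split_ifs <;> ring
  simp only [this]
  rw [Finset.sum_sub_distrib, ← Finset.mul_sum, hs, Finset.sum_ite_mem,
    Finset.inter_eq_right.mpr hU, e]
  omega

def hbPair : List ℤ → List (ℤ × ℤ)
  | a :: b :: l => (a, b) :: hbPair l
  | _ => []

theorem hbPair_lt : ∀ l : List ℤ, l.Pairwise (· < ·) → ∀ p ∈ hbPair l, p.1 < p.2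
  | [], _, p, hp => by simp [hbPair] at hp
  | [a], _, p, hp => by simp [hbPair] at hp
  | a :: b :: l, h, p, hp => by
    simp only [hbPair, List.mem_cons] at hp
    rcases hp with rfl | hp
    · simp at h; exact h.1.1
    · exact hbPair_lt l (by simp at h; exact h.2.2) p hp

theorem hbPair_len : ∀ l : List ℤ, Even l.length → 2 * (hbPair l).length = l.length
  | [], _ => by simp [hbPair]
  | [a], h => by simp at h
  | a :: b :: l, h => by
    have := hbPair_len l (by simp at h; grind)
    simp [hbPair]; omega

theorem hbPair_flat (f : ℤ → ℤ) : ∀ l : List ℤ, Even l.length →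
    (hbPair l).flatMap (fun p => [f p.1, f p.2]) = l.map f
  | [], _ => by simp [hbPair]
  | [a], h => by simp at h
  | a :: b :: l, h => by
    have := hbPair_flat f l (by simp at h; grind)
    simp [hbPair, this]

def hbD (p : ℤ × ℤ) : ℤ := p.2 - p.1

theorem hbPair_sum (c : ℤ) : ∀ (l : List ℤ) (a : ℤ), Odd l.length →
    ((hbPair (a :: l)).map hbD).sum + ((hbPair (l ++ [c])).map hbD).sum = c - a
  | [], a, h => by simp at h
  | [b], a, h => by simp [hbPair, hbD]
  | b :: a' :: l, a, h => by
    have := hbPair_sum c l a' (by simp at h; grind)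
    simp [hbPair, hbD] at this ⊢
    linarith

theorem hbPair_par (c : ℤ) : ∀ (l : List ℤ) (a : ℤ), Odd l.length →
    (∀ p ∈ hbPair (a :: l), hbD p = 2) → (∀ p ∈ hbPair (l ++ [c]), hbD p = 2) →
    ∀ e ∈ l, e % 2 = a % 2
  | [], a, h, _, _ => by simp
  | [b], a, h, h1, h2 => by simp [hbPair, hbD] at *; omega
  | b :: a' :: l, a, h, h1, h2 => by
    simp only [hbPair, List.cons_append, List.forall_mem_cons, hbD] at h1 h2
    have := hbPair_par c l a' (by simp at h; grind) h1.2 h2.2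
    simp only [List.forall_mem_cons]
    refine ⟨by omega, by omega, fun e he => ?_⟩
    have := this e he
    omega

theorem hb_pairing (n h : ℤ) (hn : n = 2 * h) (A : Finset ℤ) (hA : A ⊆ Finset.Ico 0 n)
    (hev : Even A.card) (hpos : A.Nonempty) : ∃ P : List (ℤ × ℤ), (∀ p ∈ P, p.1 < p.2) ∧
    (P.flatMap (fun p => [p.1 % n, p.2 % n])).Perm A.toList ∧ 2 * P.length = A.card ∧
    (P.map hbD).sum ≤ h ∧ ((P.map hbD).sum < h ∨ (∃ p ∈ P, hbD p ≠ 2) ∨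
      (∀ a ∈ A, ∀ b ∈ A, a % 2 = b % 2)) := by
  obtain ⟨l0, hl0⟩ : ∃ l, l = A.sort (· ≤ ·) := ⟨_, rfl⟩
  have hmem : ∀ z, z ∈ l0 ↔ z ∈ A := by intro z; rw [hl0]; simp
  have hlen : l0.length = A.card := by rw [hl0]; simp
  have hsort : l0.Pairwise (· < ·) := by rw [hl0]; exact (Finset.sortedLT_sort A).pairwise
  have hperm : l0.Perm A.toList := by
    rw [hl0]
    exact List.perm_of_nodup_nodup_toFinset_eq (Finset.sort_nodup _ _) (Finset.nodup_toList _) (by simp)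
  clear hl0
  cases l0 with
  | nil =>
    obtain ⟨a, ha⟩ := hpos
    have := (hmem a).2 ha
    simp at this
  | cons a l =>
    have hr : ∀ z ∈ a :: l, 0 ≤ z ∧ z < n := by
      intro z hz
      have := hA ((hmem z).1 hz)
      simpa using this
    have hmod : ∀ z ∈ a :: l, z % n = z := fun z hz => Int.emod_eq_of_lt (hr z hz).1 (hr z hz).2
    have hmap : (a :: l).map (fun z => z % n) = a :: l := by
      conv_rhs => rw [← List.map_id (a :: l)]
      exact List.map_congr_left hmod
    have hodd : Odd l.length := by rw [← hlen] at hev; simp at hev; grind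
    have hev1 : Even (a :: l).length := by rw [hlen]; exact hev
    have hev2 : Even (l ++ [a + n]).length := by simpa using hev1
    have hs2 : (l ++ [a + n]).Pairwise (· < ·) := by
      rw [List.pairwise_append]
      refine ⟨(List.pairwise_cons.mp hsort).2, by simp, ?_⟩
      intro z hz w hw
      simp at hw
      have h1 := hr z (by simp [hz])
      have h2 := hr a (by simp)
      omega
    have hsum := hbPair_sum (a + n) l a hodd
    have hpar := hbPair_par (a + n) l a hodd
    have p1 : ((hbPair (a :: l)).flatMap (fun p => [p.1 % n, p.2 % n])).Perm A.toList := by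
      rw [hbPair_flat (fun z => z % n) _ hev1, hmap]; exact hperm
    have p2 : ((hbPair (l ++ [a + n])).flatMap (fun p => [p.1 % n, p.2 % n])).Perm A.toList := by
      rw [hbPair_flat (fun z => z % n) _ hev2]
      refine List.Perm.trans ?_ hperm
      conv_rhs => rw [← hmap]
      simp only [List.map_append, List.map_cons, List.map_nil, Int.add_emod_right]
      exact List.perm_append_singleton _ _
    have l1 := hbPair_len _ hev1
    have l2 := hbPair_len _ hev2
    have l3 : (l ++ [a + n]).length = A.card := by rw [← hlen]; simp
    by_cases c1 : ((hbPair (a :: l)).map hbD).sum < h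
    · exact ⟨_, hbPair_lt _ hsort, p1, by omega, by omega, Or.inl c1⟩
    by_cases c2 : ((hbPair (l ++ [a + n])).map hbD).sum < h
    · exact ⟨_, hbPair_lt _ hs2, p2, by omega, by omega, Or.inl c2⟩
    by_cases c3 : ∃ p ∈ hbPair (a :: l), hbD p ≠ 2
    · exact ⟨_, hbPair_lt _ hsort, p1, by omega, by omega, Or.inr (Or.inl c3)⟩
    by_cases c4 : ∃ p ∈ hbPair (l ++ [a + n]), hbD p ≠ 2
    · exact ⟨_, hbPair_lt _ hs2, p2, by omega, by omega, Or.inr (Or.inl c4)⟩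
    push Not at c3 c4
    have := hpar c3 c4
    refine ⟨_, hbPair_lt _ hsort, p1, by omega, by omega, Or.inr (Or.inr ?_)⟩
    have key : ∀ z ∈ A, z % 2 = a % 2 := by
      intro z hz
      rcases List.mem_cons.mp ((hmem z).2 hz) with rfl | h
      · rfl
      · exact this z h
    intro u hu v hv
    rw [key u hu, key v hv]

set_option maxHeartbeats 1000000 in
theorem hb_arith (h a0 a1 b0 b1 : ℕ) (hh : 2 ≤ h) (ha0 : a0 ≤ h) (ha1 : a1 ≤ h) (hb0 : b0 ≤ h)
    (hb1 : b1 ≤ h) (hs : a0 + a1 + b0 + b1 = 2 * h + 2) :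
    (∃ c0 c1 d0 d1 : ℕ, c0 ≤ a0 ∧ c1 ≤ a1 ∧ d0 ≤ b0 ∧ d1 ≤ b1 ∧ c0 + c1 + d0 + d1 = 2 * h ∧
      (c0 + c1) % 2 = 0 ∧ (d0 + d1) % 2 = 0 ∧ 0 < c0 + c1 ∧ 0 < d0 + d1 ∧ (c1 + d1) % 2 = 0 ∧
      ((0 < c0 ∧ 0 < c1) ∨ (0 < d0 ∧ 0 < d1))) ∨
    (h = 2 ∧ a0 = 2 ∧ a1 = 2 ∧ (b0 = 0 ∨ b1 = 0)) ∨
    (h = 2 ∧ b0 = 2 ∧ b1 = 2 ∧ (a0 = 0 ∨ a1 = 0)) := by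
  rcases Nat.even_or_odd' (a0+a1) with ⟨k, hk | hk⟩ <;>
  rcases Nat.even_or_odd' (a1+b1) with ⟨j, hj | hj⟩
  · have key : (2 ≤ a0 ∧ 3 ≤ a0 + a1 ∧ ((3 ≤ a0 ∧ 1 ≤ a1) ∨ (1 ≤ b0 ∧ 1 ≤ b1))) ∨
        (2 ≤ a1 ∧ 3 ≤ a0 + a1 ∧ ((3 ≤ a1 ∧ 1 ≤ a0) ∨ (1 ≤ b0 ∧ 1 ≤ b1))) ∨
        (2 ≤ b0 ∧ 3 ≤ b0 + b1 ∧ ((3 ≤ b0 ∧ 1 ≤ b1) ∨ (1 ≤ a0 ∧ 1 ≤ a1))) ∨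
        (2 ≤ b1 ∧ 3 ≤ b0 + b1 ∧ ((3 ≤ b1 ∧ 1 ≤ b0) ∨ (1 ≤ a0 ∧ 1 ≤ a1))) ∨
        (h = 2 ∧ a0 = 2 ∧ a1 = 2 ∧ (b0 = 0 ∨ b1 = 0)) ∨
        (h = 2 ∧ b0 = 2 ∧ b1 = 2 ∧ (a0 = 0 ∨ a1 = 0)) := by
      by_cases c1 : 1 ≤ a0 ∧ 1 ≤ a1
      · by_cases c2 : 1 ≤ b0 ∧ 1 ≤ b1
        · by_cases c3 : 3 ≤ a0 + a1
          · by_cases c4 : 2 ≤ a0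
            · exact Or.inl ⟨c4, c3, Or.inr c2⟩
            · exact Or.inr (Or.inl ⟨by omega, c3, Or.inr c2⟩)
          · by_cases c4 : 2 ≤ b0
            · exact Or.inr (Or.inr (Or.inl ⟨c4, by omega, Or.inr c1⟩))
            · exact Or.inr (Or.inr (Or.inr (Or.inl ⟨by omega, by omega, Or.inr c1⟩)))
        · by_cases c3 : 3 ≤ a0
          · exact Or.inl ⟨by omega, by omega, Or.inl ⟨c3, c1.2⟩⟩
          · by_cases c4 : 3 ≤ a1
            · exact Or.inr (Or.inl ⟨by omega, by omega, Or.inl ⟨c4, c1.1⟩⟩)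
            · exact Or.inr (Or.inr (Or.inr (Or.inr (Or.inl (by omega)))))
      · by_cases c3 : 3 ≤ b0
        · exact Or.inr (Or.inr (Or.inl ⟨by omega, by omega, Or.inl ⟨c3, by omega⟩⟩))
        · by_cases c4 : 3 ≤ b1
          · exact Or.inr (Or.inr (Or.inr (Or.inl ⟨by omega, by omega, Or.inl ⟨c4, by omega⟩⟩)))
          · exact Or.inr (Or.inr (Or.inr (Or.inr (Or.inr (by omega)))))
    rcases key with q | q | q | q | q
    · exact Or.inl ⟨a0 - 2, a1, b0, b1, by omega⟩
    · exact Or.inl ⟨a0, a1 - 2, b0, b1, by omega⟩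
    · exact Or.inl ⟨a0, a1, b0 - 2, b1, by omega⟩
    · exact Or.inl ⟨a0, a1, b0, b1 - 2, by omega⟩
    · exact Or.inr q
  · left
    by_cases c : b0 + b1 ≤ a0 + a1
    · exact ⟨a0 - 1, a1 - 1, b0, b1, by omega⟩
    · exact ⟨a0, a1, b0 - 1, b1 - 1, by omega⟩
  · left
    by_cases c : 1 ≤ a0 ∧ 1 ≤ b0 ∧ ((2 ≤ a0 ∧ 1 ≤ a1) ∨ (2 ≤ b0 ∧ 1 ≤ b1))
    · exact ⟨a0 - 1, a1, b0 - 1, b1, by omega⟩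
    · exact ⟨a0, a1 - 1, b0, b1 - 1, by omega⟩
  · left
    by_cases c : 1 ≤ a0 ∧ 1 ≤ b1 ∧ ((2 ≤ a0 ∧ 1 ≤ a1) ∨ (2 ≤ b1 ∧ 1 ≤ b0))
    · exact ⟨a0 - 1, a1, b0, b1 - 1, by omega⟩
    · exact ⟨a0, a1 - 1, b0 - 1, b1, by omega⟩

theorem hb_len_le (c : ℤ) (P : List (ℤ × ℤ)) (h : ∀ p ∈ P, c ≤ hbD p) :
    c * P.length ≤ (P.map hbD).sum := by
  induction P with
  | nil => simp
  | cons a l ih =>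
    simp only [List.forall_mem_cons] at h
    have := ih h.2
    simp only [List.map_cons, List.sum_cons, List.length_cons]
    push_cast
    linarith [h.1]

theorem hb_len_lt (c : ℤ) (P : List (ℤ × ℤ)) (h : ∀ p ∈ P, c ≤ hbD p) (h2 : ∃ p ∈ P, hbD p ≠ c) :
    c * P.length < (P.map hbD).sum := by
  induction P with
  | nil => simp at h2
  | cons a l ih =>
    simp only [List.forall_mem_cons] at h
    have h3 := hb_len_le c l h.2
    simp only [List.map_cons, List.sum_cons, List.length_cons]
    push_cast
    rcases lt_or_eq_of_le h.1 with h1 | h1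
    · linarith
    · obtain ⟨p, hp, hpc⟩ := h2
      rcases List.mem_cons.mp hp with rfl | hp
      · exact absurd h1.symm hpc
      · have := ih h.2 ⟨p, hp, hpc⟩
        linarith

theorem hb_mem_le (P : List (ℤ × ℤ)) (h : ∀ p ∈ P, 1 ≤ hbD p) (p) (hp : p ∈ P) :
    hbD p ≤ (P.map hbD).sum := by
  apply List.single_le_sum
  · intro z hz
    obtain ⟨q, hq, rfl⟩ := List.mem_map.mp hz
    linarith [h q hq]
  · exact List.mem_map_of_mem hp

theorem hb_parity (n : ℤ) (hn : 2 ∣ n) (P : List (ℤ × ℤ)) :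
    2 ∣ (P.map hbD).sum - (P.flatMap (fun p => [p.1 % n, p.2 % n])).sum := by
  induction P with
  | nil => simp
  | cons a l ih =>
    simp only [List.map_cons, List.sum_cons, List.flatMap_cons, List.sum_append, List.sum_nil, hbD] at *
    have h1 := Int.emod_emod_of_dvd a.1 hn
    have h2 := Int.emod_emod_of_dvd a.2 hn
    omega

theorem hb_nodup (n : ℤ) (P : List (ℤ × ℤ))
    (h : (P.flatMap (fun p => [p.1 % n, p.2 % n])).Nodup) : P.Nodup := by
  rw [List.nodup_flatMap] at h
  refine h.2.imp ?_
  intro a b hab e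
  subst e
  simp [Function.onFun, List.Disjoint] at hab

section
variable {G : Type*} [Group G]

theorem hb_yx (x y : G) (hyx : y * x = x⁻¹ * y) (a : ℤ) : y * x ^ a = x ^ (-a) * y := by
  have : SemiconjBy y x x⁻¹ := hyx
  have h := this.zpow_right a
  rw [SemiconjBy, inv_zpow, ← zpow_neg] at h
  exact h

theorem hb_prodX (x : G) (N : List ℤ) : (N.map (fun a => x ^ a)).prod = x ^ N.sum := by
  induction N with
  | nil => simp
  | cons a l ih => simp [ih, zpow_add]

theorem hb_yxy (x y : G) (m : ℤ) (hy : y ^ 2 = x ^ m) (hyx : y * x = x⁻¹ * y) (p q s : ℤ) :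
    x ^ p * y * (x ^ s * (x ^ q * y)) = x ^ (p - s - q + m) := by
  calc x ^ p * y * (x ^ s * (x ^ q * y)) = x ^ p * (y * x ^ (s + q)) * y := by
        rw [zpow_add]; group
    _ = x ^ p * x ^ (-(s + q)) * y ^ 2 := by rw [hb_yx x y hyx, pow_two]; simp only [mul_assoc]
    _ = _ := by rw [hy, ← zpow_add, ← zpow_add]; ring_nf

def hbList (x y : G) (p q : ℤ) (N P : List ℤ) (R : List (ℤ × ℤ)) : List G :=
  x ^ p * y :: (N.map (fun a => x ^ a) ++ (x ^ q * y) :: (P.map (fun a => x ^ a) ++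
    R.flatMap (fun r => [x ^ r.1 * y, x ^ r.2 * y])))

theorem hb_prod (x y : G) (m : ℤ) (hy : y ^ 2 = x ^ m) (hyx : y * x = x⁻¹ * y) (p q : ℤ)
    (N P : List ℤ) (R : List (ℤ × ℤ)) : (hbList x y p q N P R).prod =
      x ^ (p - q + m - N.sum + P.sum + ((R.map (fun r => r.1 - r.2)).sum + R.length * m)) := by
  have hR : (R.flatMap (fun r => [x ^ r.1 * y, x ^ r.2 * y])).prod =
      x ^ ((R.map (fun r => r.1 - r.2)).sum + R.length * m) := by
    induction R with
    | nil => simp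
    | cons a l ih =>
      have := hb_yxy x y m hy hyx a.1 a.2 0
      simp only [zpow_zero, one_mul] at this
      simp only [List.flatMap_cons, List.prod_append, ih, List.prod_cons, List.prod_nil, mul_one, this,
        ← zpow_add, List.map_cons, List.sum_cons, List.length_cons]
      push_cast
      ring_nf
  simp only [hbList, List.prod_cons, List.prod_append, hR, hb_prodX]
  rw [show x ^ p * y * (x ^ N.sum * (x ^ q * y * (x ^ P.sum *
    x ^ ((R.map (fun r => r.1 - r.2)).sum + R.length * m)))) = (x ^ p * y * (x ^ N.sum * (x ^ q * y))) * x ^ P.sum *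
    x ^ ((R.map (fun r => r.1 - r.2)).sum + R.length * m) by simp only [mul_assoc],
    hb_yxy x y m hy hyx, ← zpow_add, ← zpow_add]
  ring_nf

theorem hb_permA {β : Type*} (f : ℤ → β) (oA : List (ℤ × ℤ)) :
    ((oA.map Prod.fst).map f ++ (oA.map Prod.snd).map f).Perm (oA.flatMap (fun p => [f p.1, f p.2])) := by
  induction oA with
  | nil => simp
  | cons a l ih =>
    simp only [List.map_cons, List.flatMap_cons, List.cons_append, List.nil_append]
    refine List.Perm.cons _ ?_
    refine List.perm_middle.trans (List.Perm.cons _ ih)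

theorem hb_permL (x y : G) (p q : ℤ) (oA R : List (ℤ × ℤ)) :
    (hbList x y p q (oA.map Prod.snd) (oA.map Prod.fst) R).Perm
      (oA.flatMap (fun p => [x ^ p.1, x ^ p.2]) ++
        ((p, q) :: R).flatMap (fun r => [x ^ r.1 * y, x ^ r.2 * y])) := by
  have h := hb_permA (fun a : ℤ => x ^ a) oA
  classical
  rw [List.perm_iff_count] at h ⊢
  intro a
  have := h a
  simp only [hbList, List.count_cons, List.count_append, List.flatMap_cons, List.count_nil] at this ⊢
  omega

theorem hb_sumsub (oA : List (ℤ × ℤ)) : (oA.map Prod.fst).sum - (oA.map Prod.snd).sum =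
    (oA.map (fun r => r.1 - r.2)).sum := by
  induction oA with
  | nil => simp
  | cons a l ih => simp only [List.map_cons, List.sum_cons, ← ih]; ring

theorem hb_orperm {β : Type*} (f : ℤ → β) (n : ℤ) (hf : ∀ z, f (z % n) = f z)
    (P : List (ℤ × ℤ)) (U : ℤ × ℤ → Prop) [DecidablePred U] :
    ((P.map (fun p => if U p then p.swap else p)).flatMap (fun p => [f p.1, f p.2])).Perm
      ((P.flatMap (fun p => [p.1 % n, p.2 % n])).map f) := by
  rw [List.flatMap_map, List.map_flatMap]
  apply List.Perm.flatMap_left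
  intro a _
  simp only [List.map_cons, List.map_nil, hf]
  split_ifs
  · exact List.Perm.swap _ _ _
  · exact List.Perm.refl _

theorem hb_core (n h m : ℤ) (hn : n = 2 * h) (hm : 2 ∣ m) (hnm : n ∣ 2 * m) (hh : 2 ≤ h) (x y : G)
    (hxn : x ^ n = 1) (hy : y ^ 2 = x ^ m) (hyx : y * x = x⁻¹ * y)
    (A B : Finset ℤ) (hA : A ⊆ Finset.Ico 0 n) (hB : B ⊆ Finset.Ico 0 n)
    (hA2 : Even A.card) (hB2 : Even B.card) (hA0 : A.Nonempty) (hB0 : B.Nonempty)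
    (hc : (A.card : ℤ) + B.card = n) (hs : 2 ∣ A.sum id + B.sum id)
    (hmono : ¬ ((∀ a ∈ A, ∀ b ∈ A, a % 2 = b % 2) ∧ (∀ a ∈ B, ∀ b ∈ B, a % 2 = b % 2))) :
    ∃ l : List G, l.Perm (A.toList.map (fun a => x ^ a) ++ B.toList.map (fun a => x ^ a * y)) ∧
      l.prod = 1 := by
  obtain ⟨PA, a1, a2, a3, a4, a5⟩ := hb_pairing n h hn A hA hA2 hA0
  obtain ⟨PB, b1, b2, b3, b4, b5⟩ := hb_pairing n h hn B hB hB2 hB0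
  have a1' : ∀ p ∈ PA, 1 ≤ hbD p := fun p hp => by have := a1 p hp; simp only [hbD]; omega
  have b1' : ∀ p ∈ PB, 1 ≤ hbD p := fun p hp => by have := b1 p hp; simp only [hbD]; omega
  have aN : PA.Nodup := hb_nodup n PA (a2.nodup_iff.mpr (Finset.nodup_toList _))
  have bN : PB.Nodup := hb_nodup n PB (b2.nodup_iff.mpr (Finset.nodup_toList _))
  have aP := hb_parity n ⟨h, hn⟩ PA
  have bP := hb_parity n ⟨h, hn⟩ PB
  rw [a2.sum_eq] at aP
  rw [b2.sum_eq] at bP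
  have sA : A.toList.sum = A.sum id := by simp [Finset.sum_toList]
  have sB : B.toList.sum = B.sum id := by simp [Finset.sum_toList]
  rw [sA] at aP
  rw [sB] at bP
  have hlen : (PA.length : ℤ) + PB.length = h := by omega
  have aL := hb_len_le 1 PA a1'
  have bL := hb_len_le 1 PB b1'
  let d : (ℤ × ℤ) ⊕ (ℤ × ℤ) → ℤ := Sum.elim hbD hbD
  let L : List ((ℤ × ℤ) ⊕ (ℤ × ℤ)) := PA.map Sum.inl ++ PB.map Sum.inr
  have hLl : L.length = PA.length + PB.length := by simp [L]
  have hLs : (L.map d).sum = (PA.map hbD).sum + (PB.map hbD).sum := by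
    simp [L, d, Function.comp_def]
  have hLN : L.Nodup := by
    simp only [L]
    rw [List.nodup_append]
    refine ⟨aN.map Sum.inl_injective, bN.map Sum.inr_injective, ?_⟩
    intro u hu v hv
    simp at hu hv
    rcases hu with ⟨_, _, _, rfl⟩
    rcases hv with ⟨_, _, _, rfl⟩
    simp
  have hLm : ∀ Q : (ℤ × ℤ) ⊕ (ℤ × ℤ) → Prop, (∀ i ∈ L, Q i) ↔ (∀ p ∈ PA, Q (Sum.inl p)) ∧ (∀ p ∈ PB, Q (Sum.inr p)) := by
    intro Q
    simp only [L, List.forall_mem_append, List.forall_mem_map]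
  obtain ⟨τ, hτ⟩ : ∃ τ, τ = (PB.length * m) % n := ⟨_, rfl⟩
  have hτd : n ∣ τ - PB.length * m := by
    rw [hτ]; exact (Int.mod_modEq _ _).symm.dvd
  have hτ0 : 0 ≤ τ := hτ ▸ Int.emod_nonneg _ (by omega)
  have hτn : τ < n := hτ ▸ Int.emod_lt_of_pos _ (by omega)
  have hkm2 : n ∣ 2 * (PB.length * m) := by
    rw [mul_left_comm]; exact Dvd.dvd.mul_left hnm _
  have hkm : (2:ℤ) ∣ PB.length * m := Dvd.dvd.mul_left hm _
  have hτ2 : n ∣ 2 * τ := by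
    have := dvd_add (Dvd.dvd.mul_left hτd 2) hkm2
    rwa [mul_sub, sub_add_cancel] at this
  have hτe : 2 ∣ τ := by
    have := dvd_add ((Dvd.intro h hn.symm : (2:ℤ) ∣ n).trans hτd) hkm
    rwa [sub_add_cancel] at this
  have hτh : τ ≤ h := by
    obtain ⟨c, hc⟩ := hτ2
    have : c < 2 := by
      by_contra hcc
      push Not at hcc
      nlinarith
    have : n * c ≤ n * 1 := mul_le_mul_of_nonneg_left (by omega) (by omega)
    omega
  obtain ⟨U, _, hU⟩ := hb_orient d L hLN ((hLm _).2 ⟨a1', b1'⟩)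
    ((hLm _).2 ⟨fun p hp => by
        have := hb_mem_le PA a1' p hp
        simp only [d, Sum.elim_inl, hLl]; push_cast; omega, fun p hp => by
        have := hb_mem_le PB b1' p hp
        simp only [d, Sum.elim_inr, hLl]; push_cast; omega⟩)
    (by rw [hLs, hLl]; push_cast; omega)
    (by
      by_contra hcon
      push Not at hcon
      rw [hLm] at hcon
      simp only [d, Sum.elim_inl, Sum.elim_inr] at hcon
      have a2' : ∀ p ∈ PA, 2 ≤ hbD p := fun p hp => by
        have := a1' p hp
        have := hcon.1 p hp
        omega
      have b2' : ∀ p ∈ PB, 2 ≤ hbD p := fun p hp => by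
        have := b1' p hp
        have := hcon.2 p hp
        omega
      have aL2 := hb_len_le 2 PA a2'
      have bL2 := hb_len_le 2 PB b2'
      apply hmono
      constructor
      · rcases a5 with a5 | a5 | a5
        · omega
        · have := hb_len_lt 2 PA a2' a5
          omega
        · exact a5
      · rcases b5 with a5 | a5 | a5
        · omega
        · have := hb_len_lt 2 PB b2' a5
          omega
        · exact a5)
    τ hτ0 (by rw [hLs]; omega) (by rw [hLs]; omega)
  let oA := PA.map (fun p => if U (Sum.inl p) then p.swap else p)
  let oB := PB.map (fun p => if U (Sum.inr p) then p.swap else p)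
  have hpow : ∀ z : ℤ, x ^ (z % n) = x ^ z := by
    intro z
    conv_rhs => rw [← Int.emod_add_mul_ediv z n, zpow_add, zpow_mul, hxn, one_zpow, mul_one]
  have pA := (hb_orperm (fun a : ℤ => x ^ a) n hpow PA (fun p => U (Sum.inl p))).trans (a2.map _)
  have pB := (hb_orperm (fun a : ℤ => x ^ a * y) n (fun z => by simp only [hpow]) PB
    (fun p => U (Sum.inr p))).trans (b2.map _)
  have hsum : (oA.map (fun r => r.1 - r.2)).sum + (oB.map (fun r => r.1 - r.2)).sum = τ := by
    rw [← hU]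
    simp only [L, oA, oB, List.map_append, List.sum_append, List.map_map]
    congr 2
    · apply List.map_congr_left
      intro p _
      simp only [Function.comp, d, hbD, Sum.elim_inl]
      split_ifs <;> simp
    · apply List.map_congr_left
      intro p _
      simp only [Function.comp, d, hbD, Sum.elim_inr]
      split_ifs <;> simp
  have hoBl : oB.length = PB.length := by simp [oB]
  change (oA.flatMap _).Perm _ at pA
  change (oB.flatMap _).Perm _ at pB
  clear_value oA oB
  cases oB with
  | nil =>
    have : 0 < B.card := hB0.card_pos
    simp at hoBl
    omega
  | cons r R =>
    refine ⟨_, (hb_permL x y r.1 r.2 oA R).trans (pA.append pB), ?_⟩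
    rw [hb_prod x y m hy hyx]
    have hs2 := hb_sumsub oA
    simp only [List.map_cons, List.sum_cons, List.length_cons] at hsum hoBl
    have e : r.1 - r.2 + m - (oA.map Prod.snd).sum + (oA.map Prod.fst).sum +
        ((R.map (fun r => r.1 - r.2)).sum + R.length * m) = τ + PB.length * m := by
      rw [← hoBl, ← hsum, ← hs2]; push_cast; ring
    rw [e]
    obtain ⟨c, hc⟩ : n ∣ τ + PB.length * m := by
      have := dvd_add hτd hkm2
      rwa [show τ - PB.length * m + 2 * (PB.length * m) = τ + PB.length * m by ring] at this
    rw [hc, zpow_mul, hxn, one_zpow]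
end

theorem hb_card_par (h : ℕ) (A : Finset ℤ) (hA : A ⊆ Finset.Ico 0 (2 * h : ℤ)) (c : ℤ) :
    (A.filter (fun a => a % 2 = c)).card ≤ h := by
  have : A.filter (fun a => a % 2 = c) ⊆ (Finset.range h).image (fun i : ℕ => 2 * (i : ℤ) + c) := by
    intro a ha
    rw [Finset.mem_filter] at ha
    have := Finset.mem_Ico.mp (hA ha.1)
    rw [Finset.mem_image]
    exact ⟨(a / 2).toNat, by rw [Finset.mem_range]; omega, by omega⟩
  calc _ ≤ _ := Finset.card_le_card this
    _ ≤ _ := Finset.card_image_le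
    _ = h := by simp

theorem hb_sel1 (A : Finset ℤ) (c0 c1 : ℕ) (h0 : c0 ≤ (A.filter (fun a => a % 2 = 0)).card)
    (h1 : c1 ≤ (A.filter (fun a => a % 2 = 1)).card) : ∃ A' ⊆ A, A'.card = c0 + c1 ∧
      2 ∣ A'.sum id - c1 ∧ (0 < c0 → ∃ a ∈ A', a % 2 = 0) ∧ (0 < c1 → ∃ a ∈ A', a % 2 = 1) := by
  obtain ⟨C0, s0, k0⟩ := Finset.exists_subset_card_eq h0
  obtain ⟨C1, s1, k1⟩ := Finset.exists_subset_card_eq h1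
  have m0 : ∀ a ∈ C0, a ∈ A ∧ a % 2 = 0 := fun a ha => by simpa using s0 ha
  have m1 : ∀ a ∈ C1, a ∈ A ∧ a % 2 = 1 := fun a ha => by simpa using s1 ha
  have hd : Disjoint C0 C1 := by
    rw [Finset.disjoint_left]
    intro a ha hb
    have := (m0 a ha).2
    have := (m1 a hb).2
    omega
  refine ⟨C0 ∪ C1, ?_, ?_, ?_, ?_, ?_⟩
  · intro a ha
    rcases Finset.mem_union.mp ha with h | h
    · exact (m0 a h).1
    · exact (m1 a h).1
  · rw [Finset.card_union_of_disjoint hd, k0, k1]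
  · rw [Finset.sum_union hd]
    have e0 : (2:ℤ) ∣ ∑ a ∈ C0, id a := Finset.dvd_sum (fun a ha => by
      have := (m0 a ha).2
      simp only [id]; omega)
    have e1 : (2:ℤ) ∣ ∑ a ∈ C1, (id a - 1) := Finset.dvd_sum (fun a ha => by
      have := (m1 a ha).2
      simp only [id]; omega)
    rw [Finset.sum_sub_distrib] at e1
    simp only [Finset.sum_const, k1, nsmul_eq_mul, mul_one] at e1
    omega
  · intro h
    obtain ⟨a, ha⟩ := Finset.card_pos.mp (k0 ▸ h)
    exact ⟨a, Finset.mem_union_left _ ha, (m0 a ha).2⟩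
  · intro h
    obtain ⟨a, ha⟩ := Finset.card_pos.mp (k1 ▸ h)
    exact ⟨a, Finset.mem_union_right _ ha, (m1 a ha).2⟩

theorem hb_split (A : Finset ℤ) : A.card = (A.filter (fun a => a % 2 = 0)).card +
    (A.filter (fun a => a % 2 = 1)).card := by
  rw [← Finset.card_filter_add_card_filter_not (fun a : ℤ => a % 2 = 0)]
  congr 2
  apply Finset.filter_congr
  intro a _
  omega

theorem hb_full (A : Finset ℤ) (hA : A ⊆ Finset.Ico 0 4) (h0 : (A.filter (fun a => a % 2 = 0)).card = 2)
    (h1 : (A.filter (fun a => a % 2 = 1)).card = 2) : A = Finset.Ico 0 4 := by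
  apply Finset.eq_of_subset_of_card_le hA
  rw [hb_split A, h0, h1]; simp

theorem hb_two (B : Finset ℤ) (hB : B ⊆ Finset.Ico 0 4) (c : ℤ)
    (h0 : (B.filter (fun a => a % 2 = c)).card = 2) : ∃ b ∈ B, b + 2 ∈ B := by
  obtain ⟨u, v, huv, e⟩ := Finset.card_eq_two.mp h0
  have hu : u ∈ B.filter (fun a => a % 2 = c) := by rw [e]; simp
  have hv : v ∈ B.filter (fun a => a % 2 = c) := by rw [e]; simp
  rw [Finset.mem_filter] at hu hv
  have h1 := Finset.mem_Ico.mp (hB hu.1)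
  have h2 := Finset.mem_Ico.mp (hB hv.1)
  rcases lt_or_gt_of_ne huv with h | h
  · exact ⟨u, hu.1, by rw [show u + 2 = v by omega]; exact hv.1⟩
  · exact ⟨v, hv.1, by rw [show v + 2 = u by omega]; exact hu.1⟩

theorem hb_select (h : ℕ) (hh : 2 ≤ h) (A B : Finset ℤ) (hA : A ⊆ Finset.Ico 0 (2 * h : ℤ))
    (hB : B ⊆ Finset.Ico 0 (2 * h : ℤ)) (hc : A.card + B.card = 2 * h + 2) :
    (∃ A' ⊆ A, ∃ B' ⊆ B, Even A'.card ∧ Even B'.card ∧ A'.Nonempty ∧ B'.Nonempty ∧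
      A'.card + B'.card = 2 * h ∧ 2 ∣ A'.sum id + B'.sum id ∧
      ¬ ((∀ a ∈ A', ∀ b ∈ A', a % 2 = b % 2) ∧ (∀ a ∈ B', ∀ b ∈ B', a % 2 = b % 2))) ∨
    (h = 2 ∧ A = Finset.Ico 0 4 ∧ ∃ b ∈ B, b + 2 ∈ B) ∨
    (h = 2 ∧ B = Finset.Ico 0 4) := by
  have sA := hb_split A
  have sB := hb_split B
  rcases hb_arith h _ _ _ _ hh (hb_card_par h A hA 0) (hb_card_par h A hA 1) (hb_card_par h B hB 0)
    (hb_card_par h B hB 1) (by omega) with q | ⟨rfl, q1, q2, q3⟩ | ⟨rfl, q1, q2, q3⟩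
  · obtain ⟨c0, c1, d0, d1, r1, r2, r3, r4, r5, r6, r7, r8, r9, r10, r11⟩ := q
    obtain ⟨A', t1, t2, t3, t4, t5⟩ := hb_sel1 A c0 c1 r1 r2
    obtain ⟨B', u1, u2, u3, u4, u5⟩ := hb_sel1 B d0 d1 r3 r4
    refine Or.inl ⟨A', t1, B', u1, ?_, ?_, ?_, ?_, by omega, by omega, ?_⟩
    · rw [Nat.even_iff]; omega
    · rw [Nat.even_iff]; omega
    · rw [← Finset.card_pos]; omega
    · rw [← Finset.card_pos]; omega
    · rintro ⟨k1, k2⟩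
      rcases r11 with ⟨v1, v2⟩ | ⟨v1, v2⟩
      · obtain ⟨a, ha, ha'⟩ := t4 v1
        obtain ⟨b, hb, hb'⟩ := t5 v2
        have := k1 a ha b hb
        omega
      · obtain ⟨a, ha, ha'⟩ := u4 v1
        obtain ⟨b, hb, hb'⟩ := u5 v2
        have := k2 a ha b hb
        omega
  · norm_num at hA hB
    refine Or.inr (Or.inl ⟨rfl, hb_full A hA q1 q2, ?_⟩)
    rcases q3 with q3 | q3
    · exact hb_two B hB 1 (by omega)
    · exact hb_two B hB 0 (by omega)
  · norm_num at hA hB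
    exact Or.inr (Or.inr ⟨rfl, hb_full B hB q1 q2⟩)

theorem hb_rangesum (n : ℕ) : 2 * ((List.range n).map (fun i : ℕ => (i : ℤ))).sum = n * (n - 1) := by
  induction n with
  | zero => simp
  | succ k ih =>
    rw [List.range_succ, List.map_append, List.sum_append, mul_add, ih]
    simp
    ring

theorem harborth_of_even_even (n : ℕ) (m : ℤ) (hn : 4 ≤ n) (hne : Even n) (hme : Even m)
    {G : Type*} [Group G] [Fintype G]
    (hG : Fintype.card G = 2 * n) (x y : G)
    (hx : orderOf x = n) (hy : y ^ 2 = x ^ m) (hyx : y * x = x⁻¹ * y)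
    (hgen : Subgroup.closure {x, y} = ⊤) :
    (∀ S : Finset G, S.card = n + 2 →
      ∃ l : List G, l.Nodup ∧ l.length = n ∧ (∀ a ∈ l, a ∈ S) ∧ l.prod = 1) ∧
    (∃ S : Finset G, S.card = n + 1 ∧
      ¬ ∃ l : List G, l.Nodup ∧ l.length = n ∧ (∀ a ∈ l, a ∈ S) ∧ l.prod = 1) := by
  classical
  obtain ⟨h, hh⟩ := hne
  have hh2 : n = 2 * h := by omega
  have hhz : (n : ℤ) = 2 * h := by omega
  have hxn : x ^ (n : ℤ) = 1 := by rw [zpow_natCast, ← hx, pow_orderOf_eq_one]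
  have hdvd : ∀ z : ℤ, x ^ z = 1 ↔ (n : ℤ) ∣ z := by
    intro z; rw [← hx, orderOf_dvd_iff_zpow_eq_one]
  have hyn : y ∉ Subgroup.zpowers x := by
    intro hc
    have h1 : Subgroup.closure {x, y} ≤ Subgroup.zpowers x := by
      rw [Subgroup.closure_le]
      rintro z (rfl | rfl)
      · exact Subgroup.mem_zpowers z
      · exact hc
    rw [hgen, top_le_iff] at h1
    have h2 := Nat.card_zpowers x
    rw [h1, hx, Subgroup.card_top, Nat.card_eq_fintype_card, hG] at h2
    omega
  have hXY : ∀ a b : ℤ, x ^ a ≠ x ^ b * y := by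
    intro a b e
    apply hyn
    rw [Subgroup.mem_zpowers_iff]
    exact ⟨a - b, by rw [sub_eq_neg_add, zpow_add, e, ← mul_assoc, ← zpow_add]; simp⟩
  have hinjm : ∀ a b : ℤ, x ^ a = x ^ b → (n : ℤ) ∣ a - b := by
    intro a b e
    rw [← hdvd, zpow_sub, e, mul_inv_cancel]
  have hinj : Set.InjOn (fun a : ℤ => x ^ a) (Finset.Ico (0 : ℤ) n) := by
    intro a ha b hb e
    have ha := Finset.mem_Ico.mp (Finset.mem_coe.mp ha)
    have hb := Finset.mem_Ico.mp (Finset.mem_coe.mp hb)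
    have := Int.eq_zero_of_abs_lt_dvd (hinjm a b e) (by rw [abs_lt]; omega)
    omega
  have hinjY : Set.InjOn (fun a : ℤ => x ^ a * y) (Finset.Ico (0 : ℤ) n) := by
    intro a ha b hb e
    exact hinj ha hb (mul_right_cancel e)
  have hnm : (n : ℤ) ∣ 2 * m := by
    rw [← hdvd]
    have h1 := hb_yx x y hyx m
    rw [← hy, zpow_neg, ← hy] at h1
    have h2 : y ^ 2 * y ^ 2 = 1 := by
      have : y ^ 2 = (y ^ 2)⁻¹ := by
        apply mul_right_cancel (b := y)
        rw [← h1]; simp only [pow_two, mul_assoc]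
      nth_rewrite 1 [this]
      simp
    rw [two_mul, zpow_add, ← hy, h2]
  have hdisj : ∀ A B : Finset ℤ,
      Disjoint (A.image (fun a => x ^ a)) (B.image (fun a => x ^ a * y)) := by
    intro A B
    rw [Finset.disjoint_left]
    intro g h1 h2
    simp only [Finset.mem_image] at h1 h2
    obtain ⟨a, _, rfl⟩ := h1
    obtain ⟨b, _, e⟩ := h2
    exact hXY a b e.symm
  have hcard : ∀ A B : Finset ℤ, A ⊆ Finset.Ico (0 : ℤ) n → B ⊆ Finset.Ico (0 : ℤ) n →
      (A.image (fun a => x ^ a) ∪ B.image (fun a => x ^ a * y)).card = A.card + B.card := by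
    intro A B hA hB
    rw [Finset.card_union_of_disjoint (hdisj A B), Finset.card_image_of_injOn (hinj.mono (by exact_mod_cast hA)),
      Finset.card_image_of_injOn (hinjY.mono (by exact_mod_cast hB))]
  have huniv : (Finset.Ico (0 : ℤ) n).image (fun a => x ^ a) ∪
      (Finset.Ico (0 : ℤ) n).image (fun a => x ^ a * y) = Finset.univ := by
    apply Finset.eq_univ_of_card
    rw [hcard _ _ le_rfl le_rfl, hG]
    simp; omega
  constructor
  · intro S hS
    obtain ⟨A, hAdef⟩ : ∃ A, A = (Finset.Ico (0 : ℤ) n).filter (fun a => x ^ a ∈ S) := ⟨_, rfl⟩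
    obtain ⟨B, hBdef⟩ : ∃ B, B = (Finset.Ico (0 : ℤ) n).filter (fun a => x ^ a * y ∈ S) := ⟨_, rfl⟩
    have hAI : A ⊆ Finset.Ico (0 : ℤ) n := hAdef ▸ Finset.filter_subset _ _
    have hBI : B ⊆ Finset.Ico (0 : ℤ) n := hBdef ▸ Finset.filter_subset _ _
    have hAS : ∀ a ∈ A, x ^ a ∈ S := fun a ha => by rw [hAdef] at ha; exact (Finset.mem_filter.mp ha).2
    have hBS : ∀ a ∈ B, x ^ a * y ∈ S := fun a ha => by rw [hBdef] at ha; exact (Finset.mem_filter.mp ha).2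
    have hSe : A.image (fun a => x ^ a) ∪ B.image (fun a => x ^ a * y) = S := by
      ext g
      constructor
      · intro hg
        rcases Finset.mem_union.mp hg with hg | hg
        · obtain ⟨a, ha, rfl⟩ := Finset.mem_image.mp hg
          exact hAS a ha
        · obtain ⟨a, ha, rfl⟩ := Finset.mem_image.mp hg
          exact hBS a ha
      · intro hg
        have hu := Finset.mem_univ g
        rw [← huniv] at hu
        rcases Finset.mem_union.mp hu with hu | hu
        · obtain ⟨a, ha, rfl⟩ := Finset.mem_image.mp hu
          exact Finset.mem_union_left _ (Finset.mem_image.mpr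
            ⟨a, by rw [hAdef]; exact Finset.mem_filter.mpr ⟨ha, hg⟩, rfl⟩)
        · obtain ⟨a, ha, rfl⟩ := Finset.mem_image.mp hu
          exact Finset.mem_union_right _ (Finset.mem_image.mpr
            ⟨a, by rw [hBdef]; exact Finset.mem_filter.mpr ⟨ha, hg⟩, rfl⟩)
    have hABc : A.card + B.card = n + 2 := by rw [← hcard A B hAI hBI, hSe, hS]
    have fin : ∀ (u v : List ℤ) (l : List G), u.Nodup → v.Nodup → (∀ a ∈ u, a ∈ A) →
        (∀ a ∈ v, a ∈ B) → u.length + v.length = n →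
        l.Perm (u.map (fun a => x ^ a) ++ v.map (fun a => x ^ a * y)) → l.prod = 1 →
        ∃ l : List G, l.Nodup ∧ l.length = n ∧ (∀ a ∈ l, a ∈ S) ∧ l.prod = 1 := by
      intro u v l hu hv huA hvB hlen hp hprod
      refine ⟨l, ?_, ?_, ?_, hprod⟩
      · rw [hp.nodup_iff, List.nodup_append]
        refine ⟨hu.map_on (fun a ha b hb e => hinj (hAI (huA a ha)) (hAI (huA b hb)) e),
          hv.map_on (fun a ha b hb e => hinjY (hBI (hvB a ha)) (hBI (hvB b hb)) e), ?_⟩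
        intro g hg g' hg'
        obtain ⟨a, _, rfl⟩ := List.mem_map.mp hg
        obtain ⟨b, _, rfl⟩ := List.mem_map.mp hg'
        exact hXY a b
      · rw [hp.length_eq]; simpa using hlen
      · intro g hg
        rcases List.mem_append.mp (hp.mem_iff.mp hg) with hg | hg
        · obtain ⟨a, ha, rfl⟩ := List.mem_map.mp hg
          exact hAS a (huA a ha)
        · obtain ⟨a, ha, rfl⟩ := List.mem_map.mp hg
          exact hBS a (hvB a ha)
    have hm2 : 2 ∣ m := hme.two_dvd
    rcases hb_select h (by omega) A B (hhz ▸ hAI) (hhz ▸ hBI) (by omega) with q | ⟨rfl, hA, b, hb, hb2⟩ | ⟨rfl, hB⟩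
    · obtain ⟨A', r1, B', r2, r3, r4, r5, r6, r7, r8, r9⟩ := q
      obtain ⟨l, hl, hp⟩ := hb_core n h m hhz hm2 hnm (by omega) x y hxn hy hyx A' B'
        (r1.trans hAI) (r2.trans hBI) r3 r4 r5 r6 (by omega) r8 r9
      exact fin A'.toList B'.toList l (Finset.nodup_toList _) (Finset.nodup_toList _)
        (fun a ha => r1 (by simpa using ha)) (fun a ha => r2 (by simpa using ha)) (by simp; omega) hl hp
    · have hc : (n : ℤ) ∣ m ∨ (n : ℤ) ∣ m - 6 := by
        rw [show (n : ℤ) = 4 by omega] at hnm ⊢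
        omega
      have hu : ∀ a ∈ [1, (3 : ℤ)], a ∈ A := by rw [hA]; simp
      have hv : ∀ a ∈ [b, b + 2], a ∈ B := by simp [hb, hb2]
      rcases hc with hc | hc
      · refine fin [1, 3] [b, b + 2] (hbList x y b (b + 2) [1] [3] []) (by simp) (by simp) hu hv
          (by simp; omega) ?_ ?_
        · rw [List.perm_iff_count]
          intro a
          simp only [hbList, List.map_cons, List.map_nil, List.count_cons, List.count_append, List.flatMap_nil, List.count_nil]
          omega
        · rw [hb_prod x y m hy hyx, hdvd]
          simp
          convert hc using 1
          ring
      · refine fin [1, 3] [b, b + 2] (hbList x y b (b + 2) [1, 3] [] []) (by simp) (by simp) hu hv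
          (by simp; omega) ?_ ?_
        · rw [List.perm_iff_count]
          intro a
          simp only [hbList, List.map_cons, List.map_nil, List.count_cons, List.count_append, List.flatMap_nil, List.count_nil]
          omega
        · rw [hb_prod x y m hy hyx, hdvd]
          simp
          convert hc using 1
          ring
    · refine fin [] [0, 1, 3, 2] (hbList x y 0 1 [] [] [(3, 2)]) (by simp) (by simp) (by simp)
        (by rw [hB]; simp) (by simp; omega) ?_ ?_
      · exact List.Perm.of_eq (by simp [hbList])
      · rw [hb_prod x y m hy hyx, hdvd]
        simp
        convert hnm using 1
        ring
  · refine ⟨(Finset.Ico (0 : ℤ) n).image (fun a => x ^ a) ∪ ({0} : Finset ℤ).image (fun a => x ^ a * y), ?_, ?_⟩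
    · rw [hcard _ _ le_rfl (by simp; omega)]; simp
    · rintro ⟨l, hl, hlen, hmem, hprod⟩
      have hmem' : ∀ a ∈ l, a ≠ y → a ∈ (Finset.Ico (0 : ℤ) n).image (fun a => x ^ a) := by
        intro a ha hay
        rcases Finset.mem_union.mp (hmem a ha) with h | h
        · exact h
        · simp at h; exact absurd h hay
      have hzp : ∀ a ∈ (Finset.Ico (0 : ℤ) n).image (fun a => x ^ a), a ∈ Subgroup.zpowers x := by
        intro a ha
        obtain ⟨i, _, rfl⟩ := Finset.mem_image.mp ha
        exact Subgroup.zpow_mem_zpowers x i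
      by_cases hyl : y ∈ l
      · obtain ⟨s, t, rfl⟩ := List.append_of_mem hyl
        have hn1 := List.nodup_middle.mp hl
        rw [List.nodup_cons, List.mem_append, not_or] at hn1
        have hs : s.prod ∈ Subgroup.zpowers x := Subgroup.list_prod_mem _ (fun a ha =>
          hzp a (hmem' a (by simp [ha]) (by rintro rfl; exact hn1.1.1 ha)))
        have ht : t.prod ∈ Subgroup.zpowers x := Subgroup.list_prod_mem _ (fun a ha =>
          hzp a (hmem' a (by simp [ha]) (by rintro rfl; exact hn1.1.2 ha)))
        apply hyn
        rw [List.prod_append, List.prod_cons] at hprod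
        have e : y = s.prod⁻¹ * (s.prod * (y * t.prod)) * t.prod⁻¹ := by group
        rw [e, hprod, mul_one]
        exact Subgroup.mul_mem _ (Subgroup.inv_mem _ hs) (Subgroup.inv_mem _ ht)
      · have hsub : l.toFinset ⊆ (Finset.Ico (0 : ℤ) n).image (fun a => x ^ a) := by
          intro a ha
          have ha := List.mem_toFinset.mp ha
          exact hmem' a ha (by rintro rfl; exact hyl ha)
        have heq := Finset.eq_of_subset_of_card_le hsub (by
          rw [Finset.card_image_of_injOn hinj, List.toFinset_card_of_nodup hl, hlen]; simp)
        have hperm : l.Perm (((List.range n).map (fun i : ℕ => (i : ℤ))).map (fun a => x ^ a)) := by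
          apply List.perm_of_nodup_nodup_toFinset_eq hl
          · apply List.Nodup.map_on
            · intro a ha b hb e
              simp at ha hb
              exact hinj (by simp; omega) (by simp; omega) e
            · exact List.nodup_range.map Nat.cast_injective
          · rw [heq]
            ext g
            simp only [Finset.mem_image, Finset.mem_Ico, List.mem_toFinset, List.mem_map, List.mem_range]
            constructor
            · rintro ⟨a, ha, rfl⟩
              exact ⟨a, ⟨a.toNat, by omega, by omega⟩, rfl⟩
            · rintro ⟨a, ⟨i, hi, rfl⟩, rfl⟩
              exact ⟨i, by omega, rfl⟩
        have hpe := hperm.symm.prod_eq' (by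
          rw [List.pairwise_map]
          exact List.pairwise_of_forall (fun a b => Commute.zpow_zpow_self x a b))
        rw [hb_prodX, hprod, hdvd] at hpe
        have h2 := hb_rangesum n
        obtain ⟨c, hc⟩ := hpe
        rw [hc] at h2
        have h3 : 2 * c = (n : ℤ) - 1 := by
          have hn0 : (n : ℤ) ≠ 0 := by omega
          apply mul_left_cancel₀ hn0
          linarith
        omega
end

section
/- Let n ≥ 4 and m be even integers, and let G ≅ H_{n,m} with generators x, y as above. Then for every subset S of G with |S| = n + 2, one has ∏_n(S) = G; that is, every element of G can be written as a product of n distinct elements of S in some order. -/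
theorem arithL (k a0 a1 b0 b1 ty par : ℕ) (hk : 2 ≤ k) (h0 : a0 ≤ k) (h1 : a1 ≤ k) (h2 : b0 ≤ k) (h3 : b1 ≤ k)
  (hs : a0 + a1 + b0 + b1 = 2*k+2) (hty : ty < 2) (hp : par < 2) :
  ∃ c0 c1 d0 d1, c0 ≤ a0 ∧ c1 ≤ a1 ∧ d0 ≤ b0 ∧ d1 ≤ b1 ∧ c0+c1+d0+d1 = 2*k ∧ (d0+d1)%2 = ty ∧ (c1+d1)%2 = par
   ∧ 1 ≤ d0 + d1 ∧ (1 ≤ c1 ∨ (1 ≤ d0 ∧ 1 ≤ d1)) := by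
  by_contra hc
  have K : ∀ x0 x1 y0 y1 : ℕ, (b0+b1+y0+y1)%2 = ty → (a1+b1+x1+y1)%2 = par → x0+x1+y0+y1 = 2 → ¬ (x0 ≤ a0 ∧ x1 ≤ a1 ∧ y0 ≤ b0 ∧ y1 ≤ b1 ∧ y0+y1+1 ≤ b0+b1 ∧ (x1+1 ≤ a1 ∨ (y0+1 ≤ b0 ∧ y1+1 ≤ b1))) := by
    rintro x0 x1 y0 y1 e5 e6 e7 ⟨e1,e2,e3,e4,e8,e9⟩
    exact hc ⟨a0-x0, a1-x1, b0-y0, b1-y1, by omega, by omega, by omega, by omega, by omega, by omega, by omega, by omega, by omega⟩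
  have q1 : (b0 + b1) % 2 = ty ∨ (b0+b1+1)%2 = ty := by omega
  have q2 : (a1 + b1) % 2 = par ∨ (a1+b1+1)%2 = par := by omega
  rcases q1 with q1 | q1 <;> rcases q2 with q2 | q2
  · have k1 := K 2 0 0 0 (by omega) (by omega) rfl
    have k2 := K 0 2 0 0 (by omega) (by omega) rfl
    have k3 := K 0 0 2 0 (by omega) (by omega) rfl
    have k4 := K 0 0 0 2 (by omega) (by omega) rfl
    clear K q1 q2 hc hty hp
    omega
  · have k5 := K 1 1 0 0 (by omega) (by omega) rfl
    have k0 := K 0 0 1 1 (by omega) (by omega) rfl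
    clear K q1 q2 hc hty hp
    omega
  · have k6 := K 1 0 1 0 (by omega) (by omega) rfl
    have k9 := K 0 1 0 1 (by omega) (by omega) rfl
    clear K q1 q2 hc hty hp
    omega
  · have k7 := K 1 0 0 1 (by omega) (by omega) rfl
    have k8 := K 0 1 1 0 (by omega) (by omega) rfl
    clear K q1 q2 hc hty hp
    omega

theorem altL {G : Type*} [Group G] (x y : G) (hyx : ∀ z : ℤ, y * x ^ z = x ^ (-z) * y) :
    ∀ (N : ℕ) (p q : List ℕ), p.length + q.length = N → (p.length = q.length ∨ p.length = q.length + 1) →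
    ∃ l : List ℕ, l.Perm (p ++ q) ∧
      (l.map (fun i => x ^ i * y)).prod = x ^ ((p.sum : ℤ) - (q.sum : ℤ)) * y ^ N := by
  intro N
  induction N with
  | zero =>
    intro p q h _
    have hp : p = [] := List.length_eq_zero_iff.1 (by omega)
    have hq : q = [] := List.length_eq_zero_iff.1 (by omega)
    subst hp hq
    exact ⟨[], by simp, by simp⟩
  | succ N ih =>
    intro p q h h2
    cases p with
    | nil => simp at h h2; omega
    | cons v p =>
      simp only [List.length_cons] at h h2
      obtain ⟨l, hl, hp⟩ := ih q p (by omega) (by omega)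
      refine ⟨v :: l, ?_, ?_⟩
      · simpa using hl.trans List.perm_append_comm
      · rw [List.map_cons, List.prod_cons, hp, pow_succ' y N, mul_assoc, ← mul_assoc y, hyx, ← zpow_natCast x v,
          mul_assoc, ← mul_assoc, ← zpow_add, List.sum_cons]
        congr 2
        push_cast
        ring

theorem realize {G : Type*} [Group G] (x y : G) (hyx : ∀ z : ℤ, y * x ^ z = x ^ (-z) * y)
    (A B T U : Finset ℕ) (hT : T ⊆ A) (hU : U ⊆ B) (hc : U.card = B.card / 2) (hB : 1 ≤ B.card) :
    ∃ l : List G, l.Perm (A.toList.map (fun i => x ^ i) ++ B.toList.map (fun i => x ^ i * y)) ∧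
      l.prod = x ^ (((∑ i ∈ A, i : ℕ) : ℤ) + ((∑ i ∈ B, i : ℕ) : ℤ)
        - 2 * (((∑ i ∈ T, i : ℕ) : ℤ) + ((∑ i ∈ U, i : ℕ) : ℤ))) * y ^ B.card := by
  have hs : ∀ D : Finset ℕ, D.toList.sum = ∑ i ∈ D, i := fun D => by simp
  have hx : ∀ L : List ℕ, (L.map (fun i => x ^ i)).prod = x ^ ((L.sum : ℕ) : ℤ) := by
    intro L
    induction L with
    | nil => simp
    | cons a L ih => rw [List.map_cons, List.prod_cons, ih, List.sum_cons, ← zpow_natCast, ← zpow_add]; push_cast; rfl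
  have hcV : (B \ U).card + U.card = B.card := Finset.card_sdiff_add_card_eq_card hU
  obtain ⟨v, hv⟩ : (B \ U).Nonempty := Finset.card_pos.1 (by omega)
  have hce : ((B \ U).erase v).card + 1 = (B \ U).card := Finset.card_erase_add_one hv
  obtain ⟨l, hl, hp⟩ := altL x y hyx (B.card - 1) U.toList ((B \ U).erase v).toList
    (by simp; omega) (by simp only [Finset.length_toList]; omega)
  have permA : ((A \ T).toList ++ T.toList).Perm A.toList := by
    rw [← Multiset.coe_eq_coe, ← Multiset.coe_add]
    simp only [Finset.coe_toList]
    rw [← Finset.disjUnion_val _ _ Finset.sdiff_disjoint, Finset.disjUnion_eq_union, Finset.sdiff_union_of_subset hT]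
  have permB : (v :: (U.toList ++ ((B \ U).erase v).toList)).Perm B.toList := by
    rw [← Multiset.coe_eq_coe, ← Multiset.cons_coe, ← Multiset.coe_add]
    simp only [Finset.coe_toList]
    rw [← Multiset.add_cons, Finset.erase_val, Multiset.cons_erase hv,
      ← Finset.disjUnion_val _ _ Finset.disjoint_sdiff, Finset.disjUnion_eq_union, Finset.union_sdiff_of_subset hU]
  have e1 := Finset.sum_sdiff (f := fun i : ℕ => i) hT
  have e2 := Finset.sum_sdiff (f := fun i : ℕ => i) hU
  have e3 := Finset.add_sum_erase (B \ U) (fun i : ℕ => i) hv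
  refine ⟨(A \ T).toList.map (fun i => x ^ i) ++ ((x ^ v * y) :: (T.toList.map (fun i => x ^ i) ++
    l.map (fun i => x ^ i * y))), ?_, ?_⟩
  · have pB : ((x ^ v * y) :: l.map (fun i => x ^ i * y)).Perm (B.toList.map (fun i => x ^ i * y)) := by
      have := ((hl.cons v).trans permB).map (fun i => x ^ i * y)
      simpa using this
    have pA := permA.map (fun i => x ^ i)
    rw [List.map_append] at pA
    refine List.Perm.trans ?_ (pA.append pB)
    rw [List.append_assoc]
    exact List.Perm.append_left _ List.perm_middle.symm
  · rw [List.prod_append, List.prod_cons, List.prod_append, hx, hx, hp, hs, hs, hs, hs]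
    have : y ^ B.card = y * y ^ (B.card - 1) := by rw [← pow_succ']; congr 1; omega
    rw [this, ← zpow_natCast x v]
    have : ∀ a b c d : ℤ, ∀ Y : G, x ^ a * (x ^ b * y * (x ^ c * (x ^ d * Y))) = x ^ (a + b - (c + d)) * (y * Y) := by
      intro a b c d Y
      rw [← mul_assoc (x ^ c), ← zpow_add, mul_assoc (x^b), ← mul_assoc y, hyx, sub_eq_add_neg, zpow_add, zpow_add]
      simp only [mul_assoc]
    rw [this]
    congr 2
    rw [← e1, ← e2, ← e3]
    push_cast
    ring

open scoped Pointwise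
section
variable {Q : Type*} [AddCommGroup Q] [DecidableEq Q]

def PS (A : Finset ℕ) (a : ℕ → Q) : Finset Q := ∑ i ∈ A, ({0, a i} : Finset Q)
def WS (B : Finset ℕ) (b : ℕ → Q) (f : ℕ) : Finset Q := (B.powersetCard f).image (fun U => ∑ i ∈ U, b i)

theorem mem_PS (A : Finset ℕ) (a : ℕ → Q) (z : Q) : z ∈ PS A a ↔ ∃ T ⊆ A, ∑ i ∈ T, a i = z := by
  induction A using Finset.induction_on generalizing z with
  | empty => simp [PS, eq_comm]
  | insert i A hi ih =>
    have : PS (insert i A) a = ({0, a i} : Finset Q) + PS A a := by simp [PS, Finset.sum_insert hi]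
    rw [this, Finset.mem_add]
    constructor
    · rintro ⟨u, hu, v, hv, rfl⟩
      obtain ⟨T, hT, rfl⟩ := (ih v).1 hv
      rcases Finset.mem_insert.1 hu with rfl | hu
      · exact ⟨T, hT.trans (Finset.subset_insert _ _), by simp⟩
      · rw [Finset.mem_singleton] at hu
        subst hu
        exact ⟨insert i T, Finset.insert_subset_insert _ hT, Finset.sum_insert (fun h => hi (hT h))⟩
    · rintro ⟨T, hT, rfl⟩
      by_cases h : i ∈ T
      · refine ⟨a i, by simp, ∑ j ∈ T.erase i, a j, (ih _).2 ⟨T.erase i, ?_, rfl⟩, Finset.add_sum_erase _ _ h⟩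
        intro j hj
        have := hT (Finset.mem_of_mem_erase hj)
        exact (Finset.mem_insert.1 this).resolve_left (Finset.ne_of_mem_erase hj)
      · refine ⟨0, by simp, ∑ j ∈ T, a j, (ih _).2 ⟨T, ?_, rfl⟩, by simp⟩
        intro j hj
        exact (Finset.mem_insert.1 (hT hj)).resolve_left (by rintro rfl; exact h hj)

theorem growth (A : Finset ℕ) (a : ℕ → Q) (W : Finset Q)
    (hap : ∀ d : Q, PS A a + W + {d} = PS A a + W → d = 0) :
    ∀ A0 ⊆ A, W.card + (A0.filter (fun i => a i ≠ 0)).card ≤ (PS A0 a + W).card := by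
  intro A0
  induction A0 using Finset.induction_on with
  | empty => intro _; simp [PS]
  | insert i A0 hi ih =>
    intro hA
    have h1 := ih ((Finset.subset_insert _ _).trans hA)
    have e : PS (insert i A0) a + W = (PS A0 a + W) + {0, a i} := by
      rw [PS, Finset.sum_insert hi, PS]; abel
    have e2 : (PS A0 a + W) + {0, a i} = (PS A0 a + W) ∪ ((PS A0 a + W) + {a i}) := by
      rw [Finset.insert_eq, Finset.add_union, Finset.singleton_zero, add_zero]
    rw [e, Finset.filter_insert]
    by_cases hz : a i = 0
    · simp only [hz, ne_eq, not_true_eq_false, if_false]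
      simpa using h1
    · simp only [hz, ne_eq, not_false_eq_true, if_true]
      rw [Finset.card_insert_of_notMem (by simp [hi])]
      have hsub : (PS A0 a + W) ⊆ (PS A0 a + W) + {0, a i} := by rw [e2]; exact Finset.subset_union_left
      rcases (Finset.card_le_card hsub).lt_or_eq with h | h
      · simp only [ne_eq] at h1; omega
      · exfalso
        have e3 := Finset.eq_of_subset_of_card_le hsub h.ge
        have hs : (PS A0 a + W) + {a i} ⊆ PS A0 a + W := by
          conv_rhs => rw [e3]
          rw [e2]; exact Finset.subset_union_right
        have e4 := Finset.eq_of_subset_of_card_le hs (by simp)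
        refine hz (hap _ ?_)
        have hA0 := (Finset.subset_insert i A0).trans hA
        have : PS A a = PS (A \ A0) a + PS A0 a := by
          rw [PS, PS, PS, Finset.sum_sdiff hA0]
        rw [this, add_assoc (PS (A \ A0) a), add_assoc (PS (A \ A0) a), e4]

theorem WS_lower (B C : Finset ℕ) (b : ℕ → Q) (f : ℕ) (hf : 1 ≤ f) (hC : C ⊆ B) (hinj : Set.InjOn b C)
    (hc : f - 1 + C.card ≤ B.card) : C.card ≤ (WS B b f).card := by
  have h1 : (B \ C).card + C.card = B.card := Finset.card_sdiff_add_card_eq_card hC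
  obtain ⟨R, hR, hRc⟩ := Finset.exists_subset_card_eq (s := B \ C) (n := f - 1) (by omega)
  refine Finset.card_le_card_of_injOn (fun z => b z + ∑ i ∈ R, b i) ?_ ?_
  · intro z hz
    have hzR : z ∉ R := fun h => (Finset.mem_sdiff.1 (hR h)).2 hz
    simp only [WS, Finset.coe_image, Set.mem_image, Finset.mem_coe, Finset.mem_powersetCard]
    refine ⟨insert z R, ⟨?_, ?_⟩, Finset.sum_insert hzR⟩
    · exact Finset.insert_subset (hC hz) (hR.trans Finset.sdiff_subset)
    · rw [Finset.card_insert_of_notMem hzR]; omega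
  · intro z hz w hw h
    exact hinj hz hw (add_right_cancel h)

/-- two translates inside WS -/
theorem WS_two (B C : Finset ℕ) (b : ℕ → Q) (f : ℕ) (hf : 2 ≤ f) (hC : C ⊆ B) (hinj : Set.InjOn b C)
    (w w' : ℕ) (hw : w ∈ B \ C) (hw' : w' ∈ B \ C) (hne : b w ≠ b w')
    (hc : f + C.card ≤ B.card) (hle : (WS B b f).card ≤ C.card) :
    ∃ d : Q, d ≠ 0 ∧ WS B b f + {d} = WS B b f := by
  have h1 : (B \ C).card + C.card = B.card := Finset.card_sdiff_add_card_eq_card hC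
  have hww : w ≠ w' := fun h => hne (by rw [h])
  have h2 : (((B \ C).erase w).erase w').card + 2 = (B \ C).card := by
    have := Finset.card_erase_add_one hw
    have := Finset.card_erase_add_one (Finset.mem_erase.2 ⟨hww.symm, hw'⟩)
    omega
  obtain ⟨R, hR, hRc⟩ := Finset.exists_subset_card_eq (s := ((B \ C).erase w).erase w') (n := f - 2) (by omega)
  have key : ∀ v ∈ B \ C, v ∉ R → (C.image b) + {b v + ∑ i ∈ R, b i} = WS B b f := by
    intro v hv hvR
    apply Finset.eq_of_subset_of_card_le
    · intro t ht
      obtain ⟨s, hs, s', hs', rfl⟩ := Finset.mem_add.1 ht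
      rw [Finset.mem_singleton] at hs'
      subst hs'
      obtain ⟨z, hz, rfl⟩ := Finset.mem_image.1 hs
      have hz1 : z ∉ insert v R := by
        intro h
        rcases Finset.mem_insert.1 h with h | h
        · subst h; exact (Finset.mem_sdiff.1 hv).2 hz
        · exact (Finset.mem_sdiff.1 (Finset.mem_of_mem_erase (Finset.mem_of_mem_erase (hR h)))).2 hz
      rw [WS, Finset.mem_image]
      refine ⟨insert z (insert v R), Finset.mem_powersetCard.2 ⟨?_, ?_⟩, ?_⟩
      · refine Finset.insert_subset (hC hz) (Finset.insert_subset (Finset.sdiff_subset hv) ?_)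
        intro r hr
        exact Finset.sdiff_subset (Finset.mem_of_mem_erase (Finset.mem_of_mem_erase (hR hr)))
      · rw [Finset.card_insert_of_notMem hz1, Finset.card_insert_of_notMem hvR]; omega
      · simp [Finset.sum_insert hz1, Finset.sum_insert hvR]
    · rw [Finset.card_add_singleton, Finset.card_image_of_injOn hinj]; exact hle
  have k1 := key w hw (fun h => by have := hR h; simp at this)
  have k2 := key w' hw' (fun h => by have := hR h; simp at this)
  refine ⟨b w - b w', sub_ne_zero.2 hne, ?_⟩
  conv_lhs => rw [← k2]
  rw [← k1, add_assoc, Finset.singleton_add_singleton]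
  congr 2
  abel

theorem lemQ [Fintype Q] (h q : ℕ) (hh : 1 ≤ h) (hq : Fintype.card Q = q) (A B : Finset ℕ) (a b : ℕ → Q)
    (hA : ∀ z, (A.filter (fun i => a i = z)).card ≤ 2 * h) (hB : ∀ z, (B.filter (fun i => b i = z)).card ≤ 2 * h)
    (hcard : A.card + B.card = 2 * h * q)
    (hap : ∀ d : Q, PS A a + WS B b (B.card / 2) + {d} = PS A a + WS B b (B.card / 2) → d = 0)
    (hbad : ¬ (q = 2 ∧ (∀ i ∈ A, a i = 0) ∧ ∀ i ∈ B, ∀ j ∈ B, b i = b j)) :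
    PS A a + WS B b (B.card / 2) = Finset.univ := by
  by_contra hne
  have hlt : (PS A a + WS B b (B.card / 2)).card < q := by
    rw [← hq]; exact (Finset.card_lt_univ_of_notMem (x := Classical.choose (by
      by_contra hcon; push Not at hcon; exact hne (Finset.eq_univ_iff_forall.2 hcon))) (Classical.choose_spec (p := fun x => x ∉ PS A a + WS B b (B.card / 2)) _))
  have g := growth A a _ hap A subset_rfl
  set W := WS B b (B.card / 2) with hW
  have hW1 : 1 ≤ W.card := by
    apply Finset.card_pos.2
    rw [hW, WS]
    exact (Finset.powersetCard_nonempty.2 (by omega)).image _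
  set p := (A.filter (fun i => a i ≠ 0)).card with hp
  have hpA : A.card ≤ p + 2 * h := by
    have := Finset.card_filter_add_card_filter_not (s := A) (fun i => a i = 0)
    have := hA 0
    simp only [hp, ne_eq]
    omega
  obtain ⟨C, hCB, hCi, hCe⟩ := Finset.exists_subset_injOn_image_eq_of_surjOn (f := b) (B : Set ℕ) (B.image b)
    (by rw [Finset.coe_image]; exact Set.surjOn_image _ _)
  have hCB' : C ⊆ B := by exact_mod_cast hCB
  have hu : B.card ≤ 2 * h * C.card := by
    rw [← Finset.card_image_of_injOn hCi, hCe]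
    exact Finset.card_le_mul_card_image B (2*h) (fun z _ => hB z)
  have hCq : C.card ≤ q := by
    rw [← Finset.card_image_of_injOn hCi, ← hq]; exact Finset.card_le_univ _
  have hlow : ∀ c, 1 ≤ B.card / 2 → c ≤ C.card → B.card / 2 - 1 + c ≤ B.card → c ≤ W.card := by
    intro c h1 h2 h3
    obtain ⟨D, hD, hDc⟩ := Finset.exists_subset_card_eq h2
    have := WS_lower B D b _ h1 (hD.trans hCB') (hCi.mono (by exact_mod_cast hD)) (by omega)
    rw [hDc, ← hW] at this
    exact this
  obtain ⟨q', rfl⟩ : ∃ q', q = q' + 2 := ⟨q - 2, by omega⟩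
  obtain ⟨h', rfl⟩ : ∃ h', h = h' + 1 := ⟨h - 1, by omega⟩
  have hqh : 0 ≤ h' * q' := Nat.zero_le _
  have eqc : 2 * (h' + 1) * (q' + 2) = 2 * (h' * q') + 4 * h' + 2 * q' + 4 := by ring
  rw [eqc] at hcard
  by_cases hA1 : A.card < 2 * (h' + 1)
  · have : q' + 2 ≤ C.card := by
      by_contra hcon
      have : 2 * (h' + 1) * C.card ≤ 2 * (h' + 1) * (q' + 1) := Nat.mul_le_mul_left _ (by omega)
      have e : 2 * (h' + 1) * (q' + 1) = 2 * (h' * q') + 2 * h' + 2 * q' + 2 := by ring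
      omega
    have := hlow (q' + 2) (by omega) this (by omega)
    omega
  · obtain ⟨e, he⟩ : ∃ e, A.card = 2 * (h' + 1) + e := ⟨A.card - 2 * (h' + 1), by omega⟩
    by_cases he0 : e = 0
    · subst he0
      have hCl : q' + 1 ≤ C.card := by
        by_contra hcon
        have : 2 * (h' + 1) * C.card ≤ 2 * (h' + 1) * q' := Nat.mul_le_mul_left _ (by omega)
        have e : 2 * (h' + 1) * q' = 2 * (h' * q') + 2 * q' := by ring
        omega
      have hw1 := hlow (q' + 1) (by omega) hCl (by omega)
      have hC2 : C.card = q' + 1 := by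
        by_contra hcon
        have := hlow (q' + 2) (by omega) (by omega) (by omega)
        omega
      have hp0 : p = 0 := by omega
      by_cases hq2 : q' = 0
      · subst hq2
        refine hbad ⟨rfl, ?_, ?_⟩
        · rw [hp, Finset.card_eq_zero, Finset.filter_eq_empty_iff] at hp0
          intro i hi
          simpa using hp0 hi
        · intro i hi j hj
          have hc1 : (B.image b).card ≤ 1 := by
            rw [← hCe, Finset.card_image_of_injOn hCi]; omega
          exact Finset.card_le_one.1 hc1 _ (Finset.mem_image_of_mem b hi) _ (Finset.mem_image_of_mem b hj)
      · have hBC : (B \ C).card + C.card = B.card := Finset.card_sdiff_add_card_eq_card hCB'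
        obtain ⟨q'', rfl⟩ : ∃ q'', q' = q'' + 1 := ⟨q' - 1, by omega⟩
        have e5 : h' * (q'' + 1) = h' * q'' + h' := by ring
        have : ∃ w ∈ B \ C, ∃ w' ∈ B \ C, b w ≠ b w' := by
          by_contra hcon
          push Not at hcon
          obtain ⟨w, hw⟩ : (B \ C).Nonempty := Finset.card_pos.1 (by omega)
          have hwB := Finset.mem_image_of_mem b (Finset.sdiff_subset hw)
          rw [← hCe] at hwB
          obtain ⟨c, hc, hcw⟩ := Finset.mem_image.1 hwB
          have hcn : c ∉ B \ C := fun h => (Finset.mem_sdiff.1 h).2 hc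
          have hsub : insert c (B \ C) ⊆ B.filter (fun i => b i = b w) := by
            intro i hi
            rw [Finset.mem_filter]
            rcases Finset.mem_insert.1 hi with rfl | hi
            · exact ⟨hCB' hc, hcw⟩
            · exact ⟨Finset.sdiff_subset hi, hcon _ hi _ hw⟩
          have h5 := Finset.card_le_card hsub
          rw [Finset.card_insert_of_notMem hcn] at h5
          have h6 := hB (b w)
          omega
        obtain ⟨w, hw, w', hw', hww⟩ := this
        obtain ⟨d, hd, hWd⟩ := WS_two B C b (B.card / 2) (by omega) hCB' hCi w w' hw hw' hww (by omega)
          (by rw [← hW]; omega)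
        refine hd (hap d ?_)
        rw [add_assoc, ← hW] at *
        rw [hWd]
    · by_cases hee : q' + 1 ≤ e
      · omega
      · obtain ⟨j, hj⟩ : ∃ j, q' = e + j := ⟨q' - e, by omega⟩
        have : j + 2 ≤ C.card := by
          by_contra hcon
          have : 2 * (h' + 1) * C.card ≤ 2 * (h' + 1) * (j + 1) := Nat.mul_le_mul_left _ (by omega)
          have e6 : 2 * (h' + 1) * (j + 1) = 2 * (h' * j) + 2 * h' + 2 * j + 2 := by ring
          have e7 : h' * q' = h' * e + h' * j := by rw [hj]; ring
          have := Nat.zero_le (h' * e)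
          omega
        have := hlow (j + 2) (by omega) this (by omega)
        omega

theorem PS_image {Q' : Type*} [AddCommGroup Q'] [DecidableEq Q'] (π : Q →+ Q') (A : Finset ℕ) (a : ℕ → Q) :
    PS A (fun i => π (a i)) = (PS A a).image π := by
  ext z
  rw [mem_PS, Finset.mem_image]
  constructor
  · rintro ⟨T, hT, rfl⟩
    exact ⟨_, (mem_PS _ _ _).2 ⟨T, hT, rfl⟩, map_sum _ _ _⟩
  · rintro ⟨t, ht, rfl⟩
    obtain ⟨T, hT, rfl⟩ := (mem_PS _ _ _).1 ht
    exact ⟨T, hT, (map_sum _ _ _).symm⟩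

theorem WS_image {Q' : Type*} [AddCommGroup Q'] [DecidableEq Q'] (π : Q →+ Q') (A : Finset ℕ) (a : ℕ → Q) (f : ℕ) :
    WS A (fun i => π (a i)) f = (WS A a f).image π := by
  rw [WS, WS, Finset.image_image]
  congr 1
  funext U
  simp [map_sum]
end

theorem fiber2 (k : ℕ) (A : Finset ℕ) (hA : A ⊆ Finset.range (2 * k)) (z : ZMod k) :
    (A.filter (fun i : ℕ => (i : ZMod k) = z)).card ≤ 2 := by
  have : (A.filter (fun i : ℕ => (i : ZMod k) = z)).card ≤ (Finset.range 2).card := by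
    refine Finset.card_le_card_of_injOn (fun i => i / k) ?_ ?_
    · intro i hi
      have hi' := hA (Finset.mem_filter.1 hi).1
      rw [Finset.mem_range] at hi'
      simp only [Finset.coe_range, Set.mem_Iio]
      exact Nat.div_lt_of_lt_mul (by linarith)
    · intro i hi j hj h
      have h1 := (Finset.mem_filter.1 hi).2
      have h2 := (Finset.mem_filter.1 hj).2
      have h3 := (ZMod.natCast_eq_natCast_iff' i j k).1 (h1.trans h2.symm)
      have e1 := Nat.div_add_mod i k
      have e2 := Nat.div_add_mod j k
      simp only at h
      rw [← e1, ← e2, h, h3]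
  simpa using this

theorem fiberH (k : ℕ) [NeZero k] (A : Finset ℕ) (hA : A ⊆ Finset.range (2 * k)) (H : AddSubgroup (ZMod k))
    [DecidableEq (ZMod k ⧸ H)] (z : ZMod k ⧸ H) :
    (A.filter (fun i : ℕ => QuotientAddGroup.mk' H (i : ZMod k) = z)).card ≤ 2 * Nat.card H := by
  classical
  obtain ⟨e, rfl⟩ := QuotientAddGroup.mk'_surjective H z
  have h1 := Finset.card_le_mul_card_image (f := fun i : ℕ => (i : ZMod k))
    (A.filter (fun i : ℕ => QuotientAddGroup.mk' H (i : ZMod k) = QuotientAddGroup.mk' H e)) 2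
    (fun b _ => fiber2 k _ ((Finset.filter_subset _ _).trans hA) b)
  refine h1.trans (Nat.mul_le_mul_left _ ?_)
  rw [Nat.card_eq_fintype_card]
  refine le_trans (b := (H : Set (ZMod k)).toFinset.card) ?_ (le_of_eq (Set.toFinset_card _))
  refine Finset.card_le_card_of_injOn (fun t => -e + t) ?_ ?_
  · intro t ht
    obtain ⟨i, hi, rfl⟩ := Finset.mem_image.1 (Finset.mem_coe.1 ht)
    have := (Finset.mem_filter.1 hi).2
    have := QuotientAddGroup.eq.1 this.symm
    simpa using this
  · intro t _ t' _ h
    exact add_left_cancel h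

theorem core (k : ℕ) [NeZero k] (A B : Finset ℕ) (hA : A ⊆ Finset.range (2 * k)) (hB : B ⊆ Finset.range (2 * k))
    (hc : A.card + B.card = 2 * k) (hNB : (∃ i ∈ A, i % 2 = 1) ∨ (∃ i ∈ B, ∃ j ∈ B, (i + j) % 2 = 1)) (w : ZMod k) :
    ∃ T ⊆ A, ∃ U ⊆ B, U.card = B.card / 2 ∧ ∑ i ∈ T, (i : ZMod k) + ∑ i ∈ U, (i : ZMod k) = w := by
  classical
  set c : ℕ → ZMod k := fun i => (i : ZMod k) with hcdef
  set X := PS A c + WS B c (B.card / 2) with hX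
  suffices h : w ∈ X by
    obtain ⟨u, hu, v, hv, rfl⟩ := Finset.mem_add.1 h
    obtain ⟨T, hT, rfl⟩ := (mem_PS _ _ _).1 hu
    obtain ⟨U, hU, rfl⟩ := Finset.mem_image.1 hv
    rw [Finset.mem_powersetCard] at hU
    exact ⟨T, hT, U, hU.1, hU.2, rfl⟩
  let H : AddSubgroup (ZMod k) := AddAction.stabilizer (ZMod k) X
  have hHX : ∀ e ∈ H, ∀ t ∈ X, e + t ∈ X := by
    intro e he t ht
    have h1 : e +ᵥ X = X := he
    rw [← h1]
    exact Finset.vadd_mem_vadd_finset ht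
  let π := QuotientAddGroup.mk' H
  have hpi : ∀ s t, π s = π t → s ∈ X → t ∈ X := by
    intro s t h hs
    have h2 : -s + t ∈ H := QuotientAddGroup.eq.1 h
    have := hHX _ h2 s hs
    rwa [neg_add_eq_sub, sub_add_cancel] at this
  have hXi : PS A (fun i => π (c i)) + WS B (fun i => π (c i)) (B.card / 2) = X.image π := by
    rw [PS_image, WS_image]
    exact (Finset.image_add π).symm
  have hcq : Nat.card (ZMod k) = Nat.card (ZMod k ⧸ H) * Nat.card H :=
    AddSubgroup.card_eq_card_quotient_mul_card_addSubgroup H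
  rw [Nat.card_zmod] at hcq
  have := lemQ (Q := ZMod k ⧸ H) (Nat.card H) (Nat.card (ZMod k ⧸ H)) Nat.card_pos (Nat.card_eq_fintype_card).symm
    A B (fun i => π (c i)) (fun i => π (c i)) (fiberH k A hA H) (fiberH k B hB H)
    (by rw [hc]; conv_lhs => rw [hcq]
        ring) ?_ ?_
  · rw [hXi] at this
    have h1 : π w ∈ X.image π := by rw [this]; exact Finset.mem_univ _
    obtain ⟨s, hs, hst⟩ := Finset.mem_image.1 h1
    exact hpi _ _ hst hs
  · rw [hXi]
    intro d hd
    obtain ⟨e, rfl⟩ := QuotientAddGroup.mk'_surjective H d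
    have he : e ∈ H := by
      change e +ᵥ X = X
      apply Finset.eq_of_subset_of_card_le
      · intro t ht
        obtain ⟨s, hs, rfl⟩ := Finset.mem_vadd_finset.1 ht
        have h2 : π s + π e ∈ X.image π := by
          rw [← hd]
          exact Finset.add_mem_add (Finset.mem_image_of_mem _ hs) (Finset.mem_singleton_self _)
        obtain ⟨s', hs', h3⟩ := Finset.mem_image.1 h2
        refine hpi s' _ ?_ hs'
        rw [h3, vadd_eq_add, map_add, add_comm]
      · simp
    exact (QuotientAddGroup.eq_zero_iff e).2 he
  · rintro ⟨h2, hA0, hB0⟩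
    have hidx : H.index = 2 := h2
    have hdbl : ∀ e : ZMod k, e + e ∈ H := fun e => AddSubgroup.add_self_mem_of_index_two hidx e
    have hodd : ∀ i : ℕ, i % 2 = 1 → (i : ZMod k) ∉ H := by
      intro i hi hiH
      obtain ⟨j, rfl⟩ : ∃ j, i = j + j + 1 := ⟨i / 2, by omega⟩
      push_cast at hiH
      have h1 : (1 : ZMod k) ∈ H := (H.add_mem_cancel_left (hdbl _)).1 hiH
      have : H = ⊤ := by
        rw [eq_top_iff]
        intro z _
        have := H.nsmul_mem h1 z.val
        simpa using this
      rw [this, AddSubgroup.index_top] at hidx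
      omega
    rcases hNB with ⟨i, hi, hi1⟩ | ⟨i, hi, j, hj, hij⟩
    · exact hodd i hi1 ((QuotientAddGroup.eq_zero_iff _).1 (hA0 i hi))
    · have h3 : -(c i) + c j ∈ H := QuotientAddGroup.eq.1 (hB0 i hi j hj)
      have h4 := H.add_mem (hdbl (c i)) h3
      refine hodd _ hij ?_
      push_cast
      convert h4 using 1
      simp only [hcdef]
      abel

theorem parity_sum (D : Finset ℕ) (r : ℕ) (h : ∀ i ∈ D, i % 2 = r) : (∑ i ∈ D, i) % 2 = (D.card * r) % 2 := by
  rw [Finset.sum_nat_mod, Finset.sum_congr rfl h]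
  simp

theorem parity_card (k r : ℕ) (A : Finset ℕ) (hA : A ⊆ Finset.range (2 * k)) :
    (A.filter (fun i => i % 2 = r)).card ≤ k := by
  have : (A.filter (fun i => i % 2 = r)).card ≤ (Finset.range k).card := by
    refine Finset.card_le_card_of_injOn (fun i => i / 2) ?_ ?_
    · intro i hi
      have hi' := hA (Finset.mem_filter.1 hi).1
      rw [Finset.mem_range] at hi'
      simp only [Finset.coe_range, Set.mem_Iio]
      omega
    · intro i hi j hj h
      have h1 := (Finset.mem_filter.1 hi).2
      have h2 := (Finset.mem_filter.1 hj).2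
      simp only at h
      omega
  simpa using this

/-- split a finset by parity and shrink both parts -/
theorem shrink (A : Finset ℕ) (c0 c1 : ℕ) (h0 : c0 ≤ (A.filter (fun i => i % 2 = 0)).card)
    (h1 : c1 ≤ (A.filter (fun i => i % 2 = 1)).card) :
    ∃ A' ⊆ A, A'.card = c0 + c1 ∧ (∑ i ∈ A', i) % 2 = c1 % 2 ∧ (1 ≤ c0 → ∃ i ∈ A', i % 2 = 0) ∧
      (1 ≤ c1 → ∃ i ∈ A', i % 2 = 1) := by
  obtain ⟨D0, hD0, hc0⟩ := Finset.exists_subset_card_eq h0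
  obtain ⟨D1, hD1, hc1⟩ := Finset.exists_subset_card_eq h1
  have p0 : ∀ i ∈ D0, i % 2 = 0 := fun i hi => (Finset.mem_filter.1 (hD0 hi)).2
  have p1 : ∀ i ∈ D1, i % 2 = 1 := fun i hi => (Finset.mem_filter.1 (hD1 hi)).2
  have hd : Disjoint D0 D1 := by
    rw [Finset.disjoint_left]
    intro i hi hj
    have := p0 i hi
    have := p1 i hj
    omega
  refine ⟨D0 ∪ D1, Finset.union_subset (hD0.trans (Finset.filter_subset _ _)) (hD1.trans (Finset.filter_subset _ _)),
    ?_, ?_, ?_, ?_⟩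
  · rw [Finset.card_union_of_disjoint hd, hc0, hc1]
  · rw [Finset.sum_union hd]
    have := parity_sum D0 0 p0
    have := parity_sum D1 1 p1
    omega
  · intro h
    obtain ⟨i, hi⟩ := Finset.card_pos.1 (by omega : 0 < D0.card)
    exact ⟨i, Finset.mem_union_left _ hi, p0 i hi⟩
  · intro h
    obtain ⟨i, hi⟩ := Finset.card_pos.1 (by omega : 0 < D1.card)
    exact ⟨i, Finset.mem_union_right _ hi, p1 i hi⟩

/-- For `n ≥ 4` and `m` even, every subset `S` of `H_{n,m}` of size `n + 2` satisfies
`∏_n(S) = H_{n,m}`: every group element is a product of `n` distinct elements of `S`. -/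
theorem prodTuples_eq_univ_of_card_n_add_two (n : ℕ) (m : ℤ) (hn : 4 ≤ n) (hne : Even n)
    (hme : Even m) {G : Type*} [Group G] [Fintype G]
    (hG : Fintype.card G = 2 * n) (x y : G)
    (hx : orderOf x = n) (hy : y ^ 2 = x ^ m) (hyx : y * x = x⁻¹ * y)
    (hgen : Subgroup.closure {x, y} = ⊤) :
    ∀ S : Finset G, S.card = n + 2 → prodTuples n (S : Set G) = Set.univ := by
  classical
  intro S hS
  rw [Set.eq_univ_iff_forall]
  intro g
  obtain ⟨k, hk⟩ := hne
  obtain ⟨m', hm'⟩ := hme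
  have hnk : n = 2 * k := by omega
  have : NeZero k := ⟨by omega⟩
  have hcz : Nat.card (Subgroup.zpowers x) = n := by rw [Nat.card_zpowers, hx]
  have hyH : y ∉ Subgroup.zpowers x := by
    intro h
    have h1 : Subgroup.closure {x, y} ≤ Subgroup.zpowers x := by
      rw [Subgroup.closure_le]
      rintro z (rfl | rfl)
      · exact Subgroup.mem_zpowers _
      · exact h
    rw [hgen, top_le_iff] at h1
    rw [h1, Subgroup.card_top, Nat.card_eq_fintype_card, hG] at hcz
    omega
  have hidx : (Subgroup.zpowers x).index = 2 := by
    have := (Subgroup.zpowers x).card_mul_index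
    rw [hcz, Nat.card_eq_fintype_card, hG, mul_comm 2 n] at this
    exact Nat.eq_of_mul_eq_mul_left (by omega) this
  have hz : ∀ z : ℤ, y * x ^ z = x ^ (-z) * y := by
    intro z
    have : SemiconjBy y x x⁻¹ := hyx
    have := (this.zpow_right z).eq
    rwa [inv_zpow, ← zpow_neg] at this
  have hrep : ∀ g : G, g ∈ Subgroup.zpowers x → ∃ i ∈ Finset.range n, x ^ i = g := by
    intro g hg
    rw [mem_zpowers_iff_mem_range_orderOf, hx] at hg
    simpa using hg
  have hrep2 : ∀ g : G, g ∉ Subgroup.zpowers x → ∃ i ∈ Finset.range n, x ^ i * y = g := by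
    intro g hg
    have : g * y⁻¹ ∈ Subgroup.zpowers x := by
      rw [Subgroup.mul_mem_iff_of_index_two hidx, inv_mem_iff]
      exact iff_of_false hg hyH
    obtain ⟨i, hi, h⟩ := hrep _ this
    exact ⟨i, hi, by rw [h]; group⟩
  have hinj : ∀ i ∈ Finset.range n, ∀ j ∈ Finset.range n, x ^ i = x ^ j → i = j := by
    intro i hi j hj h
    have := pow_injOn_Iio_orderOf (x := x)
    rw [hx] at this
    exact this (Finset.mem_range.1 hi) (Finset.mem_range.1 hj) h
  have hmem : ∀ i : ℕ, x ^ i ∈ Subgroup.zpowers x := fun i => Subgroup.npow_mem_zpowers x i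
  have hnmem : ∀ i : ℕ, x ^ i * y ∉ Subgroup.zpowers x := fun i h =>
    hyH (((Subgroup.zpowers x).mul_mem_cancel_left (hmem i)).1 h)
  set A := (Finset.range n).filter (fun i => x ^ i ∈ S) with hA
  set B := (Finset.range n).filter (fun i => x ^ i * y ∈ S) with hB
  have hAr : A ⊆ Finset.range n := Finset.filter_subset _ _
  have hBr : B ⊆ Finset.range n := Finset.filter_subset _ _
  have hAB : A.card + B.card = 2 * k + 2 := by
    have e : S = A.image (fun i => x ^ i) ∪ B.image (fun i => x ^ i * y) := by
      ext s
      simp only [Finset.mem_union, Finset.mem_image]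
      constructor
      · intro hs
        by_cases h : s ∈ Subgroup.zpowers x
        · obtain ⟨i, hi, rfl⟩ := hrep s h
          exact Or.inl ⟨i, Finset.mem_filter.2 ⟨hi, hs⟩, rfl⟩
        · obtain ⟨i, hi, rfl⟩ := hrep2 s h
          exact Or.inr ⟨i, Finset.mem_filter.2 ⟨hi, hs⟩, rfl⟩
      · rintro (⟨i, hi, rfl⟩ | ⟨i, hi, rfl⟩)
        · exact (Finset.mem_filter.1 hi).2
        · exact (Finset.mem_filter.1 hi).2
    have hd : Disjoint (A.image (fun i => x ^ i)) (B.image (fun i => x ^ i * y)) := by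
      rw [Finset.disjoint_left]
      intro s h1 h2
      obtain ⟨i, _, rfl⟩ := Finset.mem_image.1 h1
      obtain ⟨j, _, h⟩ := Finset.mem_image.1 h2
      exact hnmem j (h ▸ hmem i)
    rw [← hnk, ← hS, e, Finset.card_union_of_disjoint hd, Finset.card_image_of_injOn, Finset.card_image_of_injOn]
    · intro i hi j hj h
      exact hinj i (hBr hi) j (hBr hj) (mul_right_cancel h)
    · intro i hi j hj h
      exact hinj i (hAr hi) j (hAr hj) h
  obtain ⟨t, ty, hty, hg⟩ : ∃ t : ℤ, ∃ ty : ℕ, ty < 2 ∧ g = x ^ t * y ^ ty := by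
    by_cases h : g ∈ Subgroup.zpowers x
    · obtain ⟨i, hi, rfl⟩ := hrep g h
      exact ⟨i, 0, by omega, by simp⟩
    · obtain ⟨i, hi, rfl⟩ := hrep2 g h
      exact ⟨i, 1, by omega, by simp⟩
  rw [hnk] at hAr hBr
  have sp : ∀ D : Finset ℕ, (D.filter (fun i => i % 2 = 0)).card + (D.filter (fun i => i % 2 = 1)).card = D.card := by
    intro D
    rw [← Finset.card_filter_add_card_filter_not (s := D) (fun i => i % 2 = 0)]
    congr 2
    ext i
    simp
  have spA := sp A
  have spB := sp B
  obtain ⟨c0, c1, d0, d1, l0, l1, l2, l3, hsum, hdty, hpar, hd1, hnb⟩ := arithL k _ _ _ _ ty (t % 2).toNat (by omega)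
    (parity_card k 0 A hAr) (parity_card k 1 A hAr) (parity_card k 0 B hBr) (parity_card k 1 B hBr)
    (by omega) hty (by omega)
  obtain ⟨A', hA', hA'c, hA's, -, hA'1⟩ := shrink A c0 c1 l0 l1
  obtain ⟨B', hB', hB'c, hB's, hB'0, hB'1⟩ := shrink B d0 d1 l2 l3
  obtain ⟨w, hw⟩ : ∃ w : ℤ, ((∑ i ∈ A', i : ℕ) : ℤ) + ((∑ i ∈ B', i : ℕ) : ℤ) - t = 2 * w :=
    ⟨(((∑ i ∈ A', i : ℕ) : ℤ) + ((∑ i ∈ B', i : ℕ) : ℤ) - t) / 2, by clear hA'1 hB'0 hB'1 hnb; omega⟩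
  obtain ⟨T, hT, U, hU, hUc, hTU⟩ := core k A' B' (hA'.trans hAr) (hB'.trans hBr) (by omega) (by
    rcases hnb with h | ⟨h, h'⟩
    · exact Or.inl (hA'1 h)
    · obtain ⟨i, hi, hi'⟩ := hB'0 h
      obtain ⟨j, hj, hj'⟩ := hB'1 h'
      exact Or.inr ⟨i, hi, j, hj, by omega⟩) ((w + m' * ((B'.card / 2 : ℕ) : ℤ) : ℤ) : ZMod k)
  obtain ⟨l, hl, hlp⟩ := realize x y hz A' B' T U hT hU hUc (by omega)
  refine ⟨l, ?_, ?_, ?_, ?_⟩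
  · rw [hl.nodup_iff, List.nodup_append]
    refine ⟨?_, ?_, ?_⟩
    · refine List.Nodup.map_on ?_ (Finset.nodup_toList _)
      intro i hi j hj h
      rw [Finset.mem_toList] at hi hj
      exact hinj i (hnk ▸ hAr (hA' hi)) j (hnk ▸ hAr (hA' hj)) h
    · refine List.Nodup.map_on ?_ (Finset.nodup_toList _)
      intro i hi j hj h
      rw [Finset.mem_toList] at hi hj
      exact hinj i (hnk ▸ hBr (hB' hi)) j (hnk ▸ hBr (hB' hj)) (mul_right_cancel h)
    · intro s hs s' hs' h
      obtain ⟨i, _, rfl⟩ := List.mem_map.1 hs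
      obtain ⟨j, _, rfl⟩ := List.mem_map.1 hs'
      exact hnmem j (h ▸ hmem i)
  · rw [hl.length_eq]
    simp only [List.length_append, List.length_map, Finset.length_toList]
    omega
  · intro s hs
    rw [hl.mem_iff, List.mem_append] at hs
    rcases hs with hs | hs
    · obtain ⟨i, hi, rfl⟩ := List.mem_map.1 hs
      exact (Finset.mem_filter.1 (hA' (Finset.mem_toList.1 hi))).2
    · obtain ⟨i, hi, rfl⟩ := List.mem_map.1 hs
      exact (Finset.mem_filter.1 (hB' (Finset.mem_toList.1 hi))).2
  · rw [hlp, hg]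
    have hys : y ^ B'.card = x ^ (m * ((B'.card / 2 : ℕ) : ℤ)) * y ^ ty := by
      have : B'.card = 2 * (B'.card / 2) + ty := by omega
      conv_lhs => rw [this]
      rw [pow_add, pow_mul, hy, zpow_mul, zpow_natCast]
    rw [hys, ← mul_assoc, ← zpow_add]
    congr 1
    rw [zpow_eq_zpow_iff_modEq, hx, hnk]
    have h1 : ((((∑ i ∈ T, i : ℕ) : ℤ) + ((∑ i ∈ U, i : ℕ) : ℤ) : ℤ) : ZMod k)
        = ((w + m' * ((B'.card / 2 : ℕ) : ℤ) : ℤ) : ZMod k) := by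
      rw [← hTU]; push_cast; rfl
    rw [ZMod.intCast_eq_intCast_iff, Int.modEq_iff_dvd] at h1
    obtain ⟨r, hr⟩ := h1
    rw [Int.modEq_iff_dvd]
    refine ⟨-r, ?_⟩
    generalize B'.card / 2 = j at hr ⊢
    push_cast at hr hw ⊢
    linear_combination (-2) * hr - hw - hm' * (j : ℤ)
end

section
/- Let n ≥ 2 be an integer and let β₁, ..., β_s be s distinct residues in ℤ/nℤ. Consider the set of plus-minus weighted sums ∏^±({β₁,...,β_s}) = {ε₁β₁ + ε₂β₂ + ... + ε_sβ_s : each εᵢ ∈ {+1, −1}} ⊆ ℤ/nℤ. Then |∏^±({β₁,...,β_s})| ≥ s if n is odd, and |∏^±({β₁,...,β_s})| ≥ ⌈s/2⌉ if n is even. -/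
theorem pm_aux (n : ℕ) (s : ℕ) (β : Fin s → ZMod n) (i : Fin s) :
    β i + β i - ∑ j, β j ∈ {z : ZMod n | ∃ ε : Fin s → ℤ,
        (∀ i, ε i = 1 ∨ ε i = -1) ∧ z = ∑ i, ε i • β i} := by
  refine ⟨fun j => if j = i then 1 else -1, fun j => by by_cases h : j = i <;> simp [h], ?_⟩
  have h : ∀ j, (if j = i then (1 : ℤ) else -1) • β j
      = (if j = i then β j + β j else 0) - β j := by
    intro j
    by_cases h : j = i <;> simp [h]
  simp only [h, Finset.sum_sub_distrib]
  simp

theorem pm_two_torsion (m : ℕ) (hm : 0 < m) (x : ZMod (m + m)) (hx : x + x = 0) :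
    x = 0 ∨ x = (m : ZMod (m + m)) := by
  haveI : NeZero (m + m) := ⟨by omega⟩
  have hlt := ZMod.val_lt x
  have hv : ((x.val : ℕ) : ZMod (m + m)) = x := ZMod.natCast_zmod_val x
  have h : ((x.val + x.val : ℕ) : ZMod (m + m)) = 0 := by
    push_cast
    rw [hv, hx]
  rw [ZMod.natCast_eq_zero_iff] at h
  obtain ⟨k, hk⟩ := h
  have hk2 : k < 2 := by
    by_contra hc
    have : (m + m) * 2 ≤ (m + m) * k := Nat.mul_le_mul_left _ (by omega)
    omega
  rw [← hv]
  interval_cases k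
  · left
    have : x.val = 0 := by omega
    rw [this]; simp
  · right
    have : x.val = m := by omega
    rw [this]

/-- Lower bounds for the number of plus-minus weighted sums of `s` distinct residues
modulo `n`: at least `s` when `n` is odd, and at least `⌈s/2⌉` when `n` is even. -/
theorem card_pm_weighted_sums_ge (n : ℕ) (hn : 2 ≤ n) (s : ℕ) (β : Fin s → ZMod n)
    (hβ : Function.Injective β) :
    (Odd n → s ≤ Set.ncard {z : ZMod n | ∃ ε : Fin s → ℤ,
        (∀ i, ε i = 1 ∨ ε i = -1) ∧ z = ∑ i, ε i • β i}) ∧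
    (Even n → (s + 1) / 2 ≤ Set.ncard {z : ZMod n | ∃ ε : Fin s → ℤ,
        (∀ i, ε i = 1 ∨ ε i = -1) ∧ z = ∑ i, ε i • β i}) := by
  haveI : NeZero n := ⟨by omega⟩
  have key : (Finset.univ.image fun i => β i + β i - ∑ j, β j).card ≤
      Set.ncard {z : ZMod n | ∃ ε : Fin s → ℤ,
        (∀ i, ε i = 1 ∨ ε i = -1) ∧ z = ∑ i, ε i • β i} := by
    rw [← Set.ncard_coe_finset]
    apply Set.ncard_le_ncard _ (Set.toFinite _)
    intro z hz
    simp only [Finset.coe_image, Finset.coe_univ, Set.image_univ, Set.mem_range] at hz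
    obtain ⟨i, rfl⟩ := hz
    exact pm_aux n s β i
  constructor
  · intro ho
    refine le_trans ?_ key
    rw [Finset.card_image_of_injective]
    · simp
    · intro i j hij
      apply hβ
      have h2 : (2 : ZMod n) * β i = 2 * β j := by
        linear_combination hij
      have hu : IsUnit ((2 : ℕ) : ZMod n) := by
        rw [ZMod.isUnit_iff_coprime]
        exact Nat.coprime_two_left.mpr ho
      exact hu.mul_left_cancel (by exact_mod_cast h2)
  · rintro ⟨m, rfl⟩
    refine le_trans ?_ key
    have := Finset.card_le_mul_card_image (f := fun i => β i + β i - ∑ j, β j)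
      (Finset.univ : Finset (Fin s)) 2 (by
        intro b hb
        obtain ⟨i, -, rfl⟩ := Finset.mem_image.mp hb
        rw [← Finset.card_image_of_injective _ hβ]
        refine le_trans (Finset.card_le_card (t := {β i, β i + (m : ZMod (m + m))}) ?_)
          Finset.card_le_two
        intro z hz
        obtain ⟨j, hj, rfl⟩ := Finset.mem_image.mp hz
        have hj := (Finset.mem_filter.mp hj).2
        have := pm_two_torsion m (by omega) (β j - β i) (by linear_combination hj)
        simp only [Finset.mem_insert, Finset.mem_singleton]
        rcases this with h | h
        · left; linear_combination h
        · right; linear_combination h)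
    rw [Finset.card_univ, Fintype.card_fin] at this
    omega
end
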